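/- arXiv:1303.2302 — 4 statements merged into one kernel-verified Lean document; each statement's English description precedes it below -/
import Mathlib

section
/- For every n ≥ 1, h(K_n, x) = B_n^+(x), where K_n is the order complex of the poset of nonempty intervals of subsets of [n]: explicitly, letting P be the set of intervals [A,B] = {C : A ⊆ C ⊆ B} with ∅ ≠ A ⊆ B ⊆ [n], partially ordered by [A,B] ≤ [A',B'] iff A' ⊆ A and B ⊆ B', the faces of K_n are the chains in P; and h(K_n, x) = Σ_{j=0}^n c_j x^j (1−x)^{n−j}, where c_j is the number of chains of exactly j elements of P (with c_0 = 1). -/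
open Polynomial Finset

/-- A signed permutation of `[n]`, encoded by its word: position `i` (0-indexed)
holds the pair (absolute value minus one, sign) of the letter `w(a_{i+1})`. -/
def IsSP {n : ℕ} (u : Fin n → Fin n × Bool) : Prop :=
  Function.Bijective fun i => (u i).1

instance {n : ℕ} (u : Fin n → Fin n × Bool) : Decidable (IsSP u) :=
  inferInstanceAs (Decidable (Function.Bijective _))

/-- the letter `w(a_{i+1})` at position `i` of the word -/
def letterW {n : ℕ} (u : Fin n → Fin n × Bool) (i : Fin n) : ℤ :=
  if (u i).2 then ((u i).1 : ℤ) + 1 else -(((u i).1 : ℤ) + 1)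

/-- `a_{k+1}`: the element of the domain `S` with absolute value `k+1` -/
def aVal {n : ℕ} (u : Fin n → Fin n × Bool) (k : Fin n) : ℤ :=
  if ∃ j, u j = (k, true) then ((k : ℤ) + 1) else -((k : ℤ) + 1)

/-- the number of type `B` excedances -/
def excB {n : ℕ} (u : Fin n → Fin n × Bool) : ℕ :=
  (univ.filter fun k : Fin n =>
    aVal u k < letterW u k ∨ (aVal u k < 0 ∧ letterW u k = aVal u k)).card

/-- a derangement: no positive fixed point -/
def IsDerB {n : ℕ} (u : Fin n → Fin n × Bool) : Prop :=
  ∀ k : Fin n, 0 < aVal u k → letterW u k ≠ aVal u k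

instance {n : ℕ} (u : Fin n → Fin n × Bool) : Decidable (IsDerB u) := by
  unfold IsDerB; infer_instance

/-- the type `B` derangement polynomial -/
noncomputable def dB (n : ℕ) : Polynomial ℝ :=
  ∑ u ∈ univ.filter (fun u : Fin n → Fin n × Bool => IsSP u ∧ IsDerB u), X ^ excB u

/-- the number of type `B` descents -/
def desB {n : ℕ} (u : Fin n → Fin n × Bool) : ℕ :=
  (univ.filter fun i : Fin n =>
    ((i : ℕ) = 0 ∧ letterW u i < 0) ∨
    (0 < (i : ℕ) ∧ letterW u i < letterW u ⟨(i : ℕ) - 1, by have := i.isLt; omega⟩)).card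

/-- the type `B` Eulerian polynomial -/
noncomputable def Bpoly (n : ℕ) : Polynomial ℝ :=
  ∑ u ∈ univ.filter (fun u : Fin n → Fin n × Bool => IsSP u), X ^ desB u

/-- the "positive half" type `B` Eulerian polynomial -/
noncomputable def Bplus : ℕ → Polynomial ℝ
  | 0 => 1
  | n + 1 =>
    ∑ u ∈ univ.filter (fun u : Fin (n + 1) → Fin (n + 1) × Bool =>
        IsSP u ∧ 0 < letterW u (Fin.last n)), X ^ desB u

/-- the "negative half" type `B` Eulerian polynomial -/
noncomputable def Bminus : ℕ → Polynomial ℝ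
  | 0 => 0
  | n + 1 =>
    ∑ u ∈ univ.filter (fun u : Fin (n + 1) → Fin (n + 1) × Bool =>
        IsSP u ∧ letterW u (Fin.last n) < 0), X ^ desB u

/-- the number of excedances of a permutation -/
def excA {n : ℕ} (w : Equiv.Perm (Fin n)) : ℕ :=
  (univ.filter fun i : Fin n => i < w i).card

/-- the number of descents of a permutation -/
def desA {n : ℕ} (w : Equiv.Perm (Fin n)) : ℕ :=
  (univ.filter fun i : Fin n =>
    (i : ℕ) + 1 < n ∧ w ⟨((i : ℕ) + 1) % n, Nat.mod_lt _ i.pos⟩ < w i).card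

/-- the (type `A`) derangement polynomial -/
noncomputable def dA (n : ℕ) : Polynomial ℝ :=
  ∑ w ∈ univ.filter (fun w : Equiv.Perm (Fin n) => ∀ i, w i ≠ i), X ^ excA w

/-- the Eulerian polynomial, with the convention `A_0 = 0` -/
noncomputable def Apoly (n : ℕ) : Polynomial ℝ :=
  if n = 0 then 0 else ∑ w : Equiv.Perm (Fin n), X ^ desA w

/-- an interval `[A,B]` with `∅ ≠ A ⊆ B ⊆ [n]`, encoded by its pair of endpoints -/
def IntPair (n : ℕ) := {p : Finset (Fin n) × Finset (Fin n) // p.1.Nonempty ∧ p.1 ⊆ p.2}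

instance (n : ℕ) : Fintype (IntPair n) := by unfold IntPair; infer_instance
instance (n : ℕ) : DecidableEq (IntPair n) := by unfold IntPair; infer_instance

/-- the inclusion order on intervals: `[A,B] ≤ [A',B']` iff `A' ⊆ A` and `B ⊆ B'` -/
def pairLe {n : ℕ} (p q : IntPair n) : Prop := q.1.1 ⊆ p.1.1 ∧ p.1.2 ⊆ q.1.2

instance {n : ℕ} (p q : IntPair n) : Decidable (pairLe p q) := by
  unfold pairLe; exact inferInstanceAs (Decidable (_ ∧ _))

/-- a finite set of intervals forming a chain (a face of the order complex `K_n`) -/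
def isChainP {n : ℕ} (c : Finset (IntPair n)) : Prop :=
  ∀ p ∈ c, ∀ q ∈ c, pairLe p q ∨ pairLe q p

instance {n : ℕ} (c : Finset (IntPair n)) : Decidable (isChainP c) := by
  unfold isChainP; infer_instance

/-- the number of chains of exactly `j` intervals (the number of `(j-1)`-faces of `K_n`) -/
def cNum (n j : ℕ) : ℕ :=
  (univ.filter fun c : Finset (IntPair n) => isChainP c ∧ c.card = j).card

namespace KnAux

variable {n : ℕ}

/-- lower block of positives at positions at least `s` -/
def Aset (u : Fin n → Fin n × Bool) (s : Fin n) : Finset (Fin n) :=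
  univ.filter fun k => ∃ i, s ≤ i ∧ u i = (k, true)

/-- complement of the negatives at positions at least `s` -/
def Bset (u : Fin n → Fin n × Bool) (s : Fin n) : Finset (Fin n) :=
  univ.filter fun k => ¬ ∃ i, s ≤ i ∧ u i = (k, false)

/-- the open part of an interval -/
def inn (p : IntPair n) : Finset (Fin n) := p.1.2 \ p.1.1

/-- rank -/
def rk (p : IntPair n) : ℕ := (inn p).card

/-- sign -/
def sgn (c : Finset (IntPair n)) (k : Fin n) : Bool := decide (∀ p ∈ c, k ∈ p.1.2)

/-- level -/
def lev (c : Finset (IntPair n)) (k : Fin n) : ℕ := (c.filter fun p => k ∉ inn p).card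

/-- signed letter -/
def slet (c : Finset (IntPair n)) (k : Fin n) : ℤ :=
  if sgn c k then (k : ℤ) + 1 else -((k : ℤ) + 1)

/-- sorting key -/
def key (c : Finset (IntPair n)) (k : Fin n) : ℕ ×ₗ ℤ := toLex (lev c k, slet c k)

/-- sorting permutation -/
def sg (c : Finset (IntPair n)) : Equiv.Perm (Fin n) := Tuple.sort (key c)

/-- word of a chain -/
def Uw (c : Finset (IntPair n)) : Fin n → Fin n × Bool := fun i => (sg c i, sgn c (sg c i))

/-- rank set of a chain -/
def Ts (c : Finset (IntPair n)) : Finset (Fin n) := univ.filter fun i => ∃ p ∈ c, rk p = i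

/-- chain of a word and a set -/
def Ph (u : Fin n → Fin n × Bool) (S : Finset (Fin n)) : Finset (IntPair n) :=
  univ.filter fun p => ∃ s ∈ S, p.1 = (Aset u s, Bset u s)

/-- descent set -/
def Des (u : Fin n → Fin n × Bool) : Finset (Fin n) :=
  univ.filter fun i : Fin n =>
    ((i : ℕ) = 0 ∧ letterW u i < 0) ∨
    (0 < (i : ℕ) ∧ letterW u i < letterW u ⟨(i : ℕ) - 1, by have := i.isLt; omega⟩)

theorem key_lt {c : Finset (IntPair n)} {k l : Fin n} :
    key c k < key c l ↔ lev c k < lev c l ∨ (lev c k = lev c l ∧ slet c k < slet c l) := by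
  unfold key; rw [Prod.Lex.toLex_lt_toLex]

theorem slet_inj (c : Finset (IntPair n)) : Function.Injective (slet c) := by
  intro k l h
  unfold slet at h
  apply Fin.ext
  split_ifs at h <;> omega

theorem key_inj (c : Finset (IntPair n)) : Function.Injective (key c) := by
  intro k l h
  have h2 : (lev c k, slet c k) = (lev c l, slet c l) := toLex.injective h
  exact slet_inj c (Prod.ext_iff.1 h2).2

theorem sg_strict (c : Finset (IntPair n)) : StrictMono fun i => key c (sg c i) := by
  have h1 : Monotone (key c ∘ sg c) := Tuple.monotone_sort (key c)
  exact h1.strictMono_of_injective ((key_inj c).comp (sg c).injective)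

theorem letterW_Uw (c : Finset (IntPair n)) (i : Fin n) : letterW (Uw c) i = slet c (sg c i) := rfl

theorem inn_sub {p q : IntPair n} (h : pairLe p q) : inn p ⊆ inn q := by
  intro k hk
  simp only [inn, mem_sdiff] at hk ⊢
  exact ⟨h.2 hk.1, fun hh => hk.2 (h.1 hh)⟩

theorem lev_lt {c : Finset (IntPair n)} (hc : isChainP c) {p : IntPair n} (hp : p ∈ c)
    {k l : Fin n} (hk : k ∈ inn p) (hl : l ∉ inn p) : lev c k < lev c l := by
  apply Finset.card_lt_card
  rw [Finset.ssubset_iff_of_subset]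
  · exact ⟨p, by simp [hp, hl], by simp [hk]⟩
  · intro q hq
    simp only [mem_filter] at hq ⊢
    refine ⟨hq.1, fun h => ?_⟩
    rcases hc p hp q hq.1 with h1 | h1
    · exact hq.2 (inn_sub h1 hk)
    · exact hl (inn_sub h1 h)

theorem downset (I : Finset (Fin n)) (h : ∀ i j, i ≤ j → j ∈ I → i ∈ I) (i : Fin n) :
    i ∈ I ↔ (i : ℕ) < I.card := by
  constructor
  · intro hi
    have : Finset.Iic i ⊆ I := fun j hj => h j i (by simpa using hj) hi
    have := Finset.card_le_card this
    simp at this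
    omega
  · intro hi
    by_contra hn
    have : I ⊆ Finset.Iio i := by
      intro j hj
      simp only [Finset.mem_Iio]
      by_contra hh
      exact hn (h i j (not_lt.1 hh) hj)
    have := Finset.card_le_card this
    simp at this
    omega

theorem mem_inn_iff {c : Finset (IntPair n)} (hc : isChainP c) {p : IntPair n} (hp : p ∈ c)
    (i : Fin n) : sg c i ∈ inn p ↔ (i : ℕ) < rk p := by
  have h := downset ((inn p).map (sg c).symm.toEmbedding) (by
    intro i j hij hj
    simp only [Finset.mem_map_equiv, Equiv.symm_symm] at hj ⊢
    by_contra hi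
    have h1 := lev_lt hc hp hj hi
    have h2 : key c (sg c i) ≤ key c (sg c j) := (sg_strict c).monotone hij
    have h3 : key c (sg c j) < key c (sg c i) := key_lt.2 (Or.inl h1)
    exact absurd h3 (not_lt.2 h2)) i
  simpa [rk] using h

theorem A_sub_B {c : Finset (IntPair n)} (hc : isChainP c) {p q : IntPair n} (hp : p ∈ c)
    (hq : q ∈ c) : p.1.1 ⊆ q.1.2 := by
  rcases hc p hp q hq with h | h
  · exact p.2.2.trans h.2
  · exact h.1.trans q.2.2

theorem rk_lt (p : IntPair n) : rk p < n := by
  obtain ⟨a, ha⟩ := p.2.1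
  have : inn p ⊂ univ := by
    rw [Finset.ssubset_univ_iff]
    intro h
    have : a ∈ inn p := h ▸ mem_univ a
    simp only [inn, mem_sdiff] at this
    exact this.2 ha
  have := Finset.card_lt_card this
  simpa [rk] using this

theorem eq_AB {c : Finset (IntPair n)} (hc : isChainP c) {p : IntPair n} (hp : p ∈ c) (s : Fin n)
    (hs : rk p = s) : p.1 = (Aset (Uw c) s, Bset (Uw c) s) := by
  have key1 : ∀ i, s ≤ i ↔ sg c i ∉ inn p := by
    intro i
    rw [mem_inn_iff hc hp, hs, Fin.le_def]; omega
  apply Prod.ext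
  · ext k
    simp only [Aset, mem_filter, mem_univ, true_and, Uw, Prod.mk.injEq]
    constructor
    · intro hk
      refine ⟨(sg c).symm k, ?_, by simp, ?_⟩
      · rw [key1]; simp [inn, hk]
      · simp only [Equiv.apply_symm_apply, sgn, decide_eq_true_eq]
        exact fun q hq => A_sub_B hc hp hq hk
    · rintro ⟨i, hi, rfl, h2⟩
      rw [key1] at hi
      simp only [sgn, decide_eq_true_eq] at h2
      by_contra hh
      exact hi (by simp [inn, hh, h2 p hp])
  · ext k
    simp only [Bset, mem_filter, mem_univ, true_and, Uw, Prod.mk.injEq]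
    constructor
    · rintro hk ⟨i, hi, rfl, h2⟩
      rw [key1] at hi
      simp only [sgn, decide_eq_false_iff_not] at h2
      apply h2
      have : sg c i ∈ p.1.1 := by
        by_contra hh
        exact hi (by simp [inn, hh, hk])
      exact fun q hq => A_sub_B hc hp hq this
    · intro h
      by_contra hk
      refine h ⟨(sg c).symm k, ?_, by simp, ?_⟩
      · rw [key1]; simp [inn, hk]
      · simp only [Equiv.apply_symm_apply, sgn, decide_eq_false_iff_not]
        exact fun hq => hk (hq p hp)

theorem Ph_Uw {c : Finset (IntPair n)} (hc : isChainP c) : Ph (Uw c) (Ts c) = c := by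
  ext p
  simp only [Ph, Ts, mem_filter, mem_univ, true_and]
  constructor
  · rintro ⟨s, ⟨q, hq, hs⟩, h⟩
    rw [← eq_AB hc hq s hs] at h
    have : p = q := Subtype.ext h
    exact this ▸ hq
  · intro hp
    exact ⟨⟨rk p, rk_lt p⟩, ⟨p, hp, rfl⟩, eq_AB hc hp _ rfl⟩

theorem card_Ts {c : Finset (IntPair n)} (hc : isChainP c) : (Ts c).card = c.card := by
  symm
  apply Finset.card_bij (fun p _ => (⟨rk p, rk_lt p⟩ : Fin n))
  · intro p hp
    simp only [Ts, mem_filter, mem_univ, true_and]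
    exact ⟨p, hp, rfl⟩
  · intro p hp q hq h
    apply Subtype.ext
    rw [eq_AB hc hp ⟨rk p, rk_lt p⟩ rfl, eq_AB hc hq ⟨rk q, rk_lt q⟩ rfl, h]
  · intro i hi
    simp only [Ts, mem_filter, mem_univ, true_and] at hi
    obtain ⟨p, hp, h⟩ := hi
    exact ⟨p, hp, Fin.ext h⟩

theorem isSP_Uw (c : Finset (IntPair n)) : IsSP (Uw c) := (sg c).bijective

theorem des_Uw {c : Finset (IntPair n)} (hc : isChainP c) : Des (Uw c) ⊆ Ts c := by
  intro i hi
  simp only [Des, Ts, mem_filter, mem_univ, true_and] at hi ⊢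
  simp only [letterW_Uw] at hi
  rcases hi with ⟨h0, h1⟩ | ⟨h0, h1⟩
  · have h2 : sgn c (sg c i) = false := by
      by_contra h
      simp only [slet] at h1
      split_ifs at h1
      · omega
      · simp_all
    simp only [sgn, decide_eq_false_iff_not] at h2
    push Not at h2
    obtain ⟨q, hq, h3⟩ := h2
    refine ⟨q, hq, ?_⟩
    have := (mem_inn_iff hc hq i).not.1 (by simp [inn, h3])
    omega
  · have h2 := sg_strict c (show (⟨(i : ℕ) - 1, by have := i.isLt; omega⟩ : Fin n) < i by
      rw [Fin.lt_def]; simp only; omega)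
    simp only [key_lt] at h2
    have h3 := h2.resolve_right (fun h => absurd h.2 (not_lt.2 h1.le))
    by_contra hh
    push Not at hh
    apply absurd h3
    rw [not_lt]
    apply Finset.card_le_card
    intro p hp
    simp only [mem_filter] at hp ⊢
    refine ⟨hp.1, ?_⟩
    have h4 := hp.2
    rw [mem_inn_iff hc hp.1] at h4 ⊢
    have := hh p hp.1
    simp only
    omega

theorem last_Uw {c : Finset (IntPair (n + 1))} (hc : isChainP c) :
    0 < letterW (Uw c) (Fin.last n) := by
  rw [letterW_Uw]
  by_contra hneg
  have h2 : sgn c (sg c (Fin.last n)) = false := by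
    by_contra h
    apply hneg
    simp only [slet]
    rw [if_pos (by simpa using h)]; omega
  simp only [sgn, decide_eq_false_iff_not] at h2
  push Not at h2
  obtain ⟨q, hq, h3⟩ := h2
  obtain ⟨p, hp, hmax⟩ := Finset.exists_min_image c (fun p => p.1.1.card) ⟨q, hq⟩
  have hsub : ∀ r ∈ c, p.1.1 ⊆ r.1.1 := by
    intro r hr
    rcases hc p hp r hr with h | h
    · exact (Finset.eq_of_subset_of_card_le h.1 (hmax r hr)).ge
    · exact h.1
  obtain ⟨k, hk⟩ := p.2.1
  have hl : slet c k > 0 := by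
    have : sgn c k = true := by
      simp only [sgn, decide_eq_true_eq]
      exact fun r hr => A_sub_B hc hp hr hk
    simp only [slet, this, if_true]; omega
  have hlev : lev c (sg c (Fin.last n)) ≤ lev c k := by
    apply Finset.card_le_card
    intro r hr
    simp only [mem_filter] at hr ⊢
    exact ⟨hr.1, by simp [inn, hsub r hr.1 hk]⟩
  have h4 : key c (sg c (Fin.last n)) < key c k := by
    rw [key_lt]
    rcases hlev.lt_or_eq with h | h
    · exact Or.inl h
    · exact Or.inr ⟨h, by omega⟩
  have h5 : key c k ≤ key c (sg c (Fin.last n)) := by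
    have := (sg_strict c).monotone (Fin.le_last ((sg c).symm k))
    simpa using this
  exact absurd h4 (not_lt.2 h5)

section back

variable {u : Fin n → Fin n × Bool} {S : Finset (Fin n)}

theorem mem_A (hu : IsSP u) (s i : Fin n) : (u i).1 ∈ Aset u s ↔ s ≤ i ∧ (u i).2 = true := by
  simp only [Aset, mem_filter, mem_univ, true_and]
  constructor
  · rintro ⟨j, hj, h⟩
    have : j = i := hu.1 (by simp [h])
    subst this
    exact ⟨hj, by rw [h]⟩
  · rintro ⟨h1, h2⟩
    exact ⟨i, h1, by rw [← h2]⟩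

theorem mem_B (hu : IsSP u) (s i : Fin n) :
    (u i).1 ∈ Bset u s ↔ ¬ (s ≤ i ∧ (u i).2 = false) := by
  simp only [Bset, mem_filter, mem_univ, true_and]
  rw [not_iff_not]
  constructor
  · rintro ⟨j, hj, h⟩
    have : j = i := hu.1 (by simp [h])
    subst this
    exact ⟨hj, by rw [h]⟩
  · rintro ⟨h1, h2⟩
    exact ⟨i, h1, by rw [← h2]⟩

theorem mem_inn_word (hu : IsSP u) {p : IntPair n} {s : Fin n} (hp : p.1 = (Aset u s, Bset u s))
    (i : Fin n) : (u i).1 ∈ inn p ↔ i < s := by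
  simp only [inn, hp, mem_sdiff, mem_A hu, mem_B hu]
  cases (u i).2 <;> simp

theorem rk_eq (hu : IsSP u) {p : IntPair n} {s : Fin n} (hp : p.1 = (Aset u s, Bset u s)) :
    rk p = s := by
  have : inn p = (Finset.Iio s).image (fun i => (u i).1) := by
    ext k
    obtain ⟨i, rfl⟩ := hu.2 k
    rw [mem_inn_word hu hp]
    simp only [mem_image, mem_Iio]
    constructor
    · intro h; exact ⟨i, h, rfl⟩
    · rintro ⟨j, hj, h⟩
      have := hu.1 h
      exact this ▸ hj
  rw [rk, this, Finset.card_image_of_injective _ hu.1]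
  simp

theorem chain_Ph : isChainP (Ph u S) := by
  have mono : ∀ s t : Fin n, s ≤ t → ∀ p q : IntPair n, p.1 = (Aset u s, Bset u s) →
      q.1 = (Aset u t, Bset u t) → pairLe p q := by
    intro s t hst p q hp hq
    unfold pairLe
    rw [hp, hq]
    constructor
    · intro k
      simp only [Aset, mem_filter, mem_univ, true_and]
      rintro ⟨i, hi, h⟩
      exact ⟨i, hst.trans hi, h⟩
    · intro k
      simp only [Bset, mem_filter, mem_univ, true_and]
      rintro hk ⟨i, hi, h⟩
      exact hk ⟨i, hst.trans hi, h⟩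
  intro p hp q hq
  simp only [Ph, mem_filter, mem_univ, true_and] at hp hq
  obtain ⟨s, -, hp⟩ := hp
  obtain ⟨t, -, hq⟩ := hq
  rcases le_total s t with h | h
  · exact Or.inl (mono s t h p q hp hq)
  · exact Or.inr (mono t s h q p hq hp)

theorem exists_pair {u : Fin (n + 1) → Fin (n + 1) × Bool} (hu : IsSP u)
    (hl : 0 < letterW u (Fin.last n)) (s : Fin (n + 1)) :
    ∃ p : IntPair (n + 1), p.1 = (Aset u s, Bset u s) := by
  refine ⟨⟨(Aset u s, Bset u s), ⟨(u (Fin.last n)).1, ?_⟩, ?_⟩, rfl⟩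
  · rw [mem_A hu]
    refine ⟨Fin.le_last s, ?_⟩
    by_contra h
    simp only [letterW, h] at hl
    simp at hl
    omega
  · intro k hk
    obtain ⟨i, rfl⟩ := hu.2 k
    simp only at hk ⊢
    rw [mem_A hu] at hk
    rw [mem_B hu]
    simp [hk.2]

theorem Ts_Ph {u : Fin (n + 1) → Fin (n + 1) × Bool} {S : Finset (Fin (n + 1))} (hu : IsSP u)
    (hl : 0 < letterW u (Fin.last n)) : Ts (Ph u S) = S := by
  ext s
  simp only [Ts, Ph, mem_filter, mem_univ, true_and]
  constructor
  · rintro ⟨p, ⟨t, ht, hp⟩, h⟩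
    rw [rk_eq hu hp] at h
    exact (Fin.ext h) ▸ ht
  · intro hs
    obtain ⟨p, hp⟩ := exists_pair hu hl s
    exact ⟨p, ⟨s, hs, hp⟩, rk_eq hu hp⟩

theorem pos_of_no_des (hS : Des u ⊆ S) (m : ℕ) (hm : m < n)
    (h : ∀ s ∈ S, ¬ (s : ℕ) ≤ m) : 0 < letterW u ⟨m, hm⟩ := by
  induction m with
  | zero =>
    by_contra hh
    have h1 : letterW u ⟨0, hm⟩ < 0 := by
      have : letterW u ⟨0, hm⟩ ≠ 0 := by
        unfold letterW; split_ifs <;> omega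
      omega
    refine h ⟨0, hm⟩ (hS ?_) le_rfl
    simp [Des, h1]
  | succ m ih =>
    have h0 := ih (by omega) (fun s hs hh => h s hs (by omega))
    by_contra hh
    refine h ⟨m + 1, hm⟩ (hS ?_) le_rfl
    simp only [Des, mem_filter, mem_univ, true_and]
    right
    refine ⟨by omega, ?_⟩
    simp only [Nat.add_sub_cancel]
    omega

theorem sgn_Ph {u : Fin (n + 1) → Fin (n + 1) × Bool} {S : Finset (Fin (n + 1))} (hu : IsSP u)
    (hl : 0 < letterW u (Fin.last n)) (hS : Des u ⊆ S) (i : Fin (n + 1)) :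
    sgn (Ph u S) (u i).1 = (u i).2 := by
  cases h : (u i).2 with
  | true =>
    simp only [sgn, decide_eq_true_eq, Ph, mem_filter, mem_univ, true_and]
    rintro p ⟨s, hs, hp⟩
    rw [hp]
    simp only
    rw [mem_B hu]; simp [h]
  | false =>
    simp only [sgn, decide_eq_false_iff_not, Ph, mem_filter, mem_univ, true_and]
    intro hh
    have := pos_of_no_des hS i i.2 (by
      intro s hs hsi
      obtain ⟨p, hp⟩ := exists_pair hu hl s
      have h1 := hh p ⟨s, hs, hp⟩
      rw [hp] at h1
      simp only at h1
      rw [mem_B hu] at h1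
      exact h1 ⟨hsi, h⟩)
    simp only [letterW, h] at this
    simp at this
    omega

theorem slet_Ph {u : Fin (n + 1) → Fin (n + 1) × Bool} {S : Finset (Fin (n + 1))} (hu : IsSP u)
    (hl : 0 < letterW u (Fin.last n)) (hS : Des u ⊆ S) (i : Fin (n + 1)) :
    slet (Ph u S) (u i).1 = letterW u i := by
  simp only [slet, sgn_Ph hu hl hS, letterW]

theorem strict_Ph {u : Fin (n + 1) → Fin (n + 1) × Bool} {S : Finset (Fin (n + 1))} (hu : IsSP u)
    (hl : 0 < letterW u (Fin.last n)) (hS : Des u ⊆ S) :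
    StrictMono fun i => key (Ph u S) (u i).1 := by
  rw [Fin.strictMono_iff_lt_succ]
  intro i
  rw [key_lt, slet_Ph hu hl hS, slet_Ph hu hl hS]
  have hsub : ∀ p ∈ Ph u S, (u i.castSucc).1 ∉ inn p → (u i.succ).1 ∉ inn p := by
    intro p hp
    simp only [Ph, mem_filter, mem_univ, true_and] at hp
    obtain ⟨s, hs, hp⟩ := hp
    rw [mem_inn_word hu hp, mem_inn_word hu hp]
    intro h1 h2
    exact h1 (i.castSucc_lt_succ.trans h2)
  have hle : lev (Ph u S) (u i.castSucc).1 ≤ lev (Ph u S) (u i.succ).1 := by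
    apply Finset.card_le_card
    intro p hp
    simp only [mem_filter] at hp ⊢
    exact ⟨hp.1, hsub p hp.1 hp.2⟩
  by_cases hi : i.succ ∈ S
  · left
    obtain ⟨p, hp⟩ := exists_pair hu hl i.succ
    have hpm : p ∈ Ph u S := by
      simp only [Ph, mem_filter, mem_univ, true_and]
      exact ⟨_, hi, hp⟩
    apply lev_lt chain_Ph hpm
    · rw [mem_inn_word hu hp]; exact i.castSucc_lt_succ
    · rw [mem_inn_word hu hp]; exact lt_irrefl _
  · rcases hle.lt_or_eq with h | h
    · exact Or.inl h
    right
    refine ⟨h, ?_⟩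
    have hd : i.succ ∉ Des u := fun hh => hi (hS hh)
    simp only [Des, mem_filter, mem_univ, true_and, not_or, not_and, not_lt] at hd
    have h1 : letterW u i.castSucc ≤ letterW u i.succ := hd.2 (by simp)
    refine lt_of_le_of_ne h1 ?_
    intro h2
    rw [← slet_Ph hu hl hS, ← slet_Ph hu hl hS] at h2
    have := hu.1 (slet_inj _ h2)
    exact absurd this i.castSucc_lt_succ.ne

theorem Uw_Ph {u : Fin (n + 1) → Fin (n + 1) × Bool} {S : Finset (Fin (n + 1))} (hu : IsSP u)
    (hl : 0 < letterW u (Fin.last n)) (hS : Des u ⊆ S) : Uw (Ph u S) = u := by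
  have hsm := strict_Ph hu hl hS
  have h : Equiv.ofBijective _ hu = sg (Ph u S) := by
    unfold sg
    rw [Tuple.eq_sort_iff]
    refine ⟨hsm.monotone, ?_⟩
    intro i j hij h
    exact absurd h (hsm hij).ne
  funext i
  have h1 : sg (Ph u S) i = (u i).1 := by rw [← h]; rfl
  simp only [Uw, h1, sgn_Ph hu hl hS]

end back

theorem sum_super {N : ℕ} (D : Finset (Fin N)) :
    ∑ S ∈ univ.filter (fun S : Finset (Fin N) => D ⊆ S),
      (X : Polynomial ℝ) ^ S.card * (1 - X) ^ (N - S.card) = X ^ D.card := by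
  have h1 : ∑ T ∈ (Dᶜ).powerset, (X : Polynomial ℝ) ^ T.card * (1 - X) ^ ((Dᶜ).card - T.card)
      = 1 := by
    rw [Finset.sum_pow_mul_eq_add_pow]; simp
  have h2 : (X : Polynomial ℝ) ^ D.card = X ^ D.card *
      ∑ T ∈ (Dᶜ).powerset, (X : Polynomial ℝ) ^ T.card * (1 - X) ^ ((Dᶜ).card - T.card) := by
    rw [h1, mul_one]
  rw [h2, Finset.mul_sum]
  symm
  apply Finset.sum_nbij' (fun T => D ∪ T) (fun S => S \ D)
  · intro T hT; simp
  · intro S hS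
    simp only [mem_powerset]
    intro k hk
    simp only [mem_sdiff] at hk
    simp [hk.2]
  · intro T hT
    simp only [mem_powerset] at hT
    have : Disjoint D T := by
      rw [Finset.disjoint_left]; intro a ha hb
      simpa [ha] using hT hb
    exact Finset.union_sdiff_cancel_left this
  · intro S hS
    simp only [mem_filter, mem_univ, true_and] at hS
    exact Finset.union_sdiff_of_subset hS
  · intro T hT
    simp only [mem_powerset] at hT
    have : Disjoint D T := by
      rw [Finset.disjoint_left]; intro a ha hb
      simpa [ha] using hT hb
    rw [Finset.card_union_of_disjoint this, Finset.card_compl, Fintype.card_fin, Nat.sub_sub]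
    ring

theorem main (n : ℕ) :
    (∑ j ∈ Finset.range (n + 1 + 1),
      (cNum (n + 1) j : Polynomial ℝ) * X ^ j * (1 - X) ^ (n + 1 - j)) = Bplus (n + 1) := by
  have hL : (∑ j ∈ Finset.range (n + 1 + 1),
      (cNum (n + 1) j : Polynomial ℝ) * X ^ j * (1 - X) ^ (n + 1 - j)) =
      ∑ c ∈ univ.filter (fun c : Finset (IntPair (n + 1)) => isChainP c),
        (X : Polynomial ℝ) ^ c.card * (1 - X) ^ (n + 1 - c.card) := by
    rw [← Finset.sum_fiberwise_of_maps_to (t := Finset.range (n + 1 + 1)) 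
      (g := fun c : Finset (IntPair (n + 1)) => c.card)]
    · apply Finset.sum_congr rfl
      intro j hj
      rw [Finset.sum_congr rfl (g := fun _ => (X : Polynomial ℝ) ^ j * (1 - X) ^ (n + 1 - j))]
      · rw [Finset.sum_const, Finset.filter_filter, nsmul_eq_mul, mul_assoc]
        rfl
      · intro c hc
        simp only [mem_filter] at hc
        rw [hc.2]
    · intro c hc
      simp only [mem_filter, mem_univ, true_and] at hc
      rw [← card_Ts hc, Finset.mem_range]
      have := Finset.card_le_univ (Ts c)
      simp at this
      omega
  rw [hL]
  have hR : Bplus (n + 1) = ∑ u ∈ univ.filter (fun u : Fin (n + 1) → Fin (n + 1) × Bool =>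
        IsSP u ∧ 0 < letterW u (Fin.last n)),
      ∑ S ∈ univ.filter (fun S : Finset (Fin (n + 1)) => Des u ⊆ S),
      (X : Polynomial ℝ) ^ S.card * (1 - X) ^ (n + 1 - S.card) := by
    simp only [sum_super]
    rfl
  rw [hR, Finset.sum_sigma']
  refine Finset.sum_bij' (fun c _ => ⟨Uw c, Ts c⟩) (fun x _ => Ph x.1 x.2) ?_ ?_ ?_ ?_ ?_
  · intro c hc
    simp only [mem_filter, mem_univ, true_and, mem_sigma] at hc ⊢
    exact ⟨⟨isSP_Uw c, last_Uw hc⟩, des_Uw hc⟩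
  · intro x hx
    simp only [mem_filter, mem_univ, true_and]
    exact chain_Ph
  · intro c hc
    simp only [mem_filter, mem_univ, true_and] at hc
    exact Ph_Uw hc
  · rintro ⟨u, S⟩ hx
    simp only [mem_filter, mem_univ, true_and, mem_sigma] at hx
    simp only [Uw_Ph hx.1.1 hx.1.2 hx.2, Ts_Ph hx.1.1 hx.1.2]
  · intro c hc
    simp only [mem_filter, mem_univ, true_and] at hc
    simp only [card_Ts hc]

end KnAux

/-- For `n ≥ 1`, the `h`-polynomial of the simplicial complex `K_n` (the order complex of
the poset of intervals `[A,B]` with `∅ ≠ A ⊆ B ⊆ [n]`) equals `B_n^+(x)`. -/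
theorem h_Kn_eq_Bplus (n : ℕ) (hn : 1 ≤ n) :
    (∑ j ∈ Finset.range (n + 1), (cNum n j : Polynomial ℝ) * X ^ j * (1 - X) ^ (n - j))
      = Bplus n := by
  obtain ⟨m, rfl⟩ : ∃ m, n = m + 1 := ⟨n - 1, by omega⟩
  exact KnAux.main m
end

section
/- For every n ≥ 1, B_n^+(x) = E_2((1+x)^n A_n(x)); that is, for every k ≥ 0, the coefficient of x^k in B_n^+(x) equals the coefficient of x^{2k} in (1+x)^n A_n(x). -/
open Polynomial Finset

namespace EulAux

/-- the word of a signed permutation as a sequence starting with the convention letter 0 -/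
def gW {n : ℕ} (u : Fin n → Fin n × Bool) : ℕ → ℤ
  | 0 => 0
  | i + 1 => if h : i < n then letterW u ⟨i, h⟩ else 0

/-- number of descents among the first `n` steps -/
def dN (G : ℕ → ℤ) (n : ℕ) : ℕ := ∑ i ∈ range n, if G (i + 1) < G i then 1 else 0

/-- insertion of the largest letter -/
def ins {n : ℕ} (p : Fin (n + 1)) (s : Bool) (v : Fin n → Fin n × Bool) :
    Fin (n + 1) → Fin (n + 1) × Bool :=
  Fin.insertNth (α := fun _ => Fin (n + 1) × Bool) p (Fin.last n, s)
    (fun i => ((v i).1.castSucc, (v i).2))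

lemma desB_eq {n : ℕ} (u : Fin n → Fin n × Bool) : desB u = dN (gW u) n := by
  unfold desB dN
  rw [Finset.card_filter, ← Fin.sum_univ_eq_sum_range (fun i => if gW u (i+1) < gW u i then 1 else 0)]
  refine Finset.sum_congr rfl fun i _ => ?_
  obtain ⟨i, hi⟩ := i
  cases i with
  | zero => simp [gW, hi]
  | succ i => 
    have : i < n := by omega
    simp [gW, hi, this]

lemma gW_bound {n : ℕ} (u : Fin n → Fin n × Bool) (i : ℕ) :
    -((n : ℤ) + 1) < gW u i ∧ gW u i < (n : ℤ) + 1 := by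
  cases i with
  | zero => simp [gW]; omega
  | succ i =>
    simp only [gW]
    split_ifs with h
    · have := (u ⟨i, h⟩).1.isLt
      unfold letterW
      split_ifs <;> omega
    · omega

lemma gW_ins {n : ℕ} (p : Fin (n + 1)) (s : Bool) (v : Fin n → Fin n × Bool) (i : ℕ) :
    gW (ins p s v) i = if i ≤ p then gW v i else if i = p + 1 then
      (if s then (n : ℤ) + 1 else -((n : ℤ) + 1)) else gW v (i - 1) := by
  cases i with
  | zero => simp [gW]
  | succ i =>
    by_cases h : i < n + 1
    · have hp := p.isLt
      rcases lt_trichotomy i (p : ℕ) with h1 | h1 | h1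
      · have hin : i < n := by omega
        have : (⟨i, h⟩ : Fin (n+1)) = p.succAbove ⟨i, hin⟩ := by
          rw [Fin.succAbove_of_castSucc_lt _ _ (by simpa [Fin.lt_def] using h1)]; rfl
        rw [if_pos (by omega)]
        simp only [gW, h, hin, dif_pos]
        rw [this]
        simp [letterW, ins]
      · have : (⟨i, h⟩ : Fin (n+1)) = p := by ext; exact h1
        rw [if_neg (by omega), if_pos (by omega)]
        simp only [gW, h, dif_pos]
        rw [this]
        simp [letterW, ins]
      · obtain ⟨j, rfl⟩ : ∃ j, i = j + 1 := ⟨i - 1, by omega⟩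
        have hin : j < n := by omega
        have : (⟨j + 1, h⟩ : Fin (n+1)) = p.succAbove ⟨j, hin⟩ := by
          rw [Fin.succAbove_of_le_castSucc _ _ (by simp [Fin.le_def]; omega)]; rfl
        rw [if_neg (by omega), if_neg (by omega)]
        simp only [gW, h, hin, dif_pos, Nat.add_sub_cancel]
        rw [this]
        simp [letterW, ins]
    · have hp := p.isLt
      rw [if_neg (by omega), if_neg (by omega)]
      obtain ⟨j, rfl⟩ : ∃ j, i = j + 1 := ⟨i - 1, by omega⟩
      have : ¬ j < n := by omega
      simp [gW, h, this]

lemma des_ins_last {n : ℕ} (s : Bool) (v : Fin n → Fin n × Bool) :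
    desB (ins (Fin.last n) s v) = desB v + if s then 0 else 1 := by
  rw [desB_eq, desB_eq]
  unfold dN
  have h0 : ∀ i ≤ n, gW (ins (Fin.last n) s v) i = gW v i := by
    intro i hi
    rw [gW_ins, if_pos (by simpa using hi)]
  have h1 : gW (ins (Fin.last n) s v) (n + 1) =
      if s then (n : ℤ) + 1 else -((n : ℤ) + 1) := by
    rw [gW_ins, if_neg (by simp), if_pos (by simp)]
  rw [Finset.sum_range_succ, h1, h0 n le_rfl]
  congr 1
  · refine Finset.sum_congr rfl fun i hi => ?_
    have := Finset.mem_range.1 hi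
    rw [h0 i (by omega), h0 (i + 1) (by omega)]
  · have := gW_bound v n
    cases s
    · rw [if_pos (by simpa using this.1), if_neg (by simp)]
    · rw [if_neg (by simpa using this.2.le), if_pos rfl]

lemma des_ins_cast {n : ℕ} (p : Fin n) (s : Bool) (v : Fin n → Fin n × Bool) :
    desB (ins p.castSucc s v) + (if gW v (p + 1) < gW v p then 1 else 0) = desB v + 1 := by
  rw [desB_eq, desB_eq]
  unfold dN
  obtain ⟨p, hp⟩ := p
  obtain ⟨q, rfl⟩ : ∃ q, n = p + 1 + q := ⟨n - (p + 1), by omega⟩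
  rw [show range (p + 1 + q + 1) = range (p + 1 + 1 + q) from congrArg _ (by omega),
    Finset.sum_range_add _ (p + 1 + 1) q, Finset.sum_range_add _ (p + 1) q,
    Finset.sum_range_succ, Finset.sum_range_succ, Finset.sum_range_succ]
  have lo : ∀ i ≤ p, gW (ins (Fin.castSucc ⟨p, hp⟩) s v) i = gW v i := by
    intro i hi
    rw [gW_ins, if_pos (by simpa using hi)]
  have hi' : ∀ i, p < i → gW (ins (Fin.castSucc ⟨p, hp⟩) s v) (i + 1) = gW v i := by
    intro i hi
    rw [gW_ins, if_neg (by rw [Fin.val_castSucc]; dsimp only; omega),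
      if_neg (by rw [Fin.val_castSucc]; dsimp only; omega), Nat.add_sub_cancel]
  have e1 : ∀ i ∈ range p, (if gW (ins (Fin.castSucc ⟨p, hp⟩) s v) (i + 1) <
      gW (ins (Fin.castSucc ⟨p, hp⟩) s v) i then 1 else 0) =
      if gW v (i + 1) < gW v i then 1 else 0 := by
    intro i hi
    have := Finset.mem_range.1 hi
    rw [lo i (by omega), lo (i + 1) (by omega)]
  have e2 : ∀ i ∈ range q, (if gW (ins (Fin.castSucc ⟨p, hp⟩) s v) (p + 1 + 1 + i + 1) <
      gW (ins (Fin.castSucc ⟨p, hp⟩) s v) (p + 1 + 1 + i) then 1 else 0) =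
      if gW v (p + 1 + i + 1) < gW v (p + 1 + i) then 1 else 0 := by
    intro i hi
    rw [hi' _ (by omega), show p + 1 + 1 + i = p + 1 + i + 1 by omega, hi' _ (by omega)]
  rw [Finset.sum_congr rfl e1, Finset.sum_congr rfl e2]
  have h0 : gW (ins (Fin.castSucc ⟨p, hp⟩) s v) p = gW v p := by
    rw [gW_ins, if_pos (by simp)]
  have h1 : gW (ins (Fin.castSucc ⟨p, hp⟩) s v) (p + 1) =
      if s then ((p + 1 + q : ℕ) : ℤ) + 1 else -(((p + 1 + q : ℕ) : ℤ) + 1) := by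
    rw [gW_ins, if_neg (by simp), if_pos (by simp)]
  have h2 : gW (ins (Fin.castSucc ⟨p, hp⟩) s v) (p + 1 + 1) = gW v (p + 1) := by
    exact hi' _ (by omega)
  rw [h0, h1, h2]
  have b1 := gW_bound v p
  have b2 := gW_bound v (p + 1)
  have : (if (if s then ((p + 1 + q : ℕ) : ℤ) + 1 else -(((p + 1 + q : ℕ) : ℤ) + 1)) < gW v p
      then 1 else 0) + (if gW v (p + 1) <
      (if s then ((p + 1 + q : ℕ) : ℤ) + 1 else -(((p + 1 + q : ℕ) : ℤ) + 1)) then 1 else 0) = 1 := by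
    cases s
    · rw [if_pos (by simpa using b1.1), if_neg (by simpa using b2.1.le)]
    · rw [if_neg (by simpa using b1.2.le), if_pos (by simpa using b2.2)]
  dsimp only at this ⊢
  omega

lemma ins_last_fst {n : ℕ} (p : Fin (n + 1)) (s : Bool) (v : Fin n → Fin n × Bool) :
    ins p s v p = (Fin.last n, s) := by simp [ins]

lemma ins_succAbove {n : ℕ} (p : Fin (n + 1)) (s : Bool) (v : Fin n → Fin n × Bool) (i : Fin n) :
    ins p s v (p.succAbove i) = ((v i).1.castSucc, (v i).2) := by simp [ins]

lemma isSP_iff {n : ℕ} (u : Fin n → Fin n × Bool) :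
    IsSP u ↔ Function.Injective fun i => (u i).1 := by
  unfold IsSP; exact (Finite.injective_iff_bijective).symm

lemma isSP_ins {n : ℕ} (p : Fin (n + 1)) (s : Bool) (v : Fin n → Fin n × Bool) (hv : IsSP v) :
    IsSP (ins p s v) := by
  rw [isSP_iff] at *
  intro i j h
  dsimp only at h
  rcases Fin.eq_self_or_eq_succAbove p i with hi | ⟨i, rfl⟩ <;>
  rcases Fin.eq_self_or_eq_succAbove p j with hj | ⟨j, rfl⟩
  · rw [hi, hj]
  · rw [hi, ins_last_fst, ins_succAbove] at h
    exact absurd h.symm (Fin.castSucc_lt_last _).ne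
  · rw [hj, ins_last_fst, ins_succAbove] at h
    exact absurd h (Fin.castSucc_lt_last _).ne
  · rw [ins_succAbove, ins_succAbove] at h
    rw [hv (Fin.castSucc_injective _ h)]

lemma ins_inj {n : ℕ} {p p' : Fin (n + 1)} {s s' : Bool} {v v' : Fin n → Fin n × Bool}
    (h : ins p s v = ins p' s' v') : p = p' ∧ s = s' ∧ v = v' := by
  have hp : p = p' := by
    rcases Fin.eq_self_or_eq_succAbove p' p with rfl | ⟨i, hi⟩
    · rfl
    · have := congrFun h p
      rw [ins_last_fst, hi, ins_succAbove] at this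
      exact absurd (congrArg Prod.fst this).symm (Fin.castSucc_lt_last _).ne
  subst hp
  refine ⟨rfl, ?_, ?_⟩
  · have := congrFun h p
    rw [ins_last_fst, ins_last_fst] at this
    exact congrArg Prod.snd this
  · funext i
    have := congrFun h (p.succAbove i)
    rw [ins_succAbove, ins_succAbove] at this
    have h1 := congrArg Prod.fst this
    have h2 := congrArg Prod.snd this
    exact Prod.ext (Fin.castSucc_injective _ h1) h2

lemma ins_surj {n : ℕ} (u : Fin (n + 1) → Fin (n + 1) × Bool) (hu : IsSP u) :
    ∃ p s v, IsSP v ∧ ins p s v = u := by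
  obtain ⟨p, hp⟩ := hu.2 (Fin.last n)
  have hi := hu.1
  have hne : ∀ i, (u (p.succAbove i)).1 ≠ Fin.last n := by
    intro i h
    exact Fin.succAbove_ne p i (hi (h.trans hp.symm))
  refine ⟨p, (u p).2, fun i => ((u (p.succAbove i)).1.castPred (hne i), (u (p.succAbove i)).2), ?_, ?_⟩
  · rw [isSP_iff]
    intro i j h
    have h' : (u (p.succAbove i)).1 = (u (p.succAbove j)).1 := by simpa using h
    exact Fin.succAbove_right_injective (hi h')
  · funext i
    rcases Fin.eq_self_or_eq_succAbove p i with rfl | ⟨i, rfl⟩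
    · rw [ins_last_fst]; exact Prod.ext hp.symm rfl
    · rw [ins_succAbove]; simp

/-- all signed permutations -/
def SP (n : ℕ) : Finset (Fin n → Fin n × Bool) := univ.filter IsSP

lemma sum_SP {n : ℕ} (f : (Fin (n + 1) → Fin (n + 1) × Bool) → ℝ[X]) :
    ∑ u ∈ SP (n + 1), f u = ∑ v ∈ SP n, ∑ s : Bool, ∑ p : Fin (n + 1), f (ins p s v) := by
  simp_rw [← Finset.sum_product']
  symm
  refine Finset.sum_bij (fun (x : ((Fin n → Fin n × Bool) × Bool × Fin (n + 1))) _ =>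
    ins x.2.2 x.2.1 x.1) ?_ ?_ ?_ ?_
  · rintro ⟨v, s, p⟩ h
    simp only [SP, mem_product, mem_filter, mem_univ, true_and, and_true] at h ⊢
    exact isSP_ins _ _ _ h
  · rintro ⟨v, s, p⟩ _ ⟨v', s', p'⟩ _ h
    obtain ⟨rfl, rfl, rfl⟩ := ins_inj h
    rfl
  · intro u hu
    simp only [SP, mem_filter, mem_univ, true_and] at hu
    obtain ⟨p, s, v, hv, h⟩ := ins_surj u hu
    exact ⟨(v, s, p), by simp [SP, hv], h⟩
  · rintro ⟨v, s, p⟩ _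
    rfl

/-- the differential operator -/
noncomputable def opL (n : ℕ) (q : ℝ[X]) : ℝ[X] :=
  X * derivative q + (n : ℝ[X]) * X * q - X ^ 2 * derivative q

lemma opL_sum {ι : Type*} (n : ℕ) (s : Finset ι) (f : ι → ℝ[X]) :
    opL n (∑ i ∈ s, f i) = ∑ i ∈ s, opL n (f i) := by
  simp only [opL, derivative_sum, Finset.mul_sum, Finset.sum_add_distrib, Finset.sum_sub_distrib]

lemma opL_zero (n : ℕ) : opL n 0 = 0 := by simp [opL]

lemma sum_ins {n : ℕ} (s : Bool) (v : Fin n → Fin n × Bool) :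
    ∑ p : Fin n, (X : ℝ[X]) ^ desB (ins p.castSucc s v) = opL n (X ^ desB v) := by
  have h : ∀ p : Fin n, (X : ℝ[X]) ^ desB (ins p.castSucc s v) =
      X ^ (desB v + 1) + ((if gW v (p + 1) < gW v p then 1 else 0 : ℕ) : ℝ[X]) *
        (X ^ desB v - X ^ (desB v + 1)) := by
    intro p
    have := des_ins_cast p s v
    split_ifs at this ⊢ with hh
    · rw [Nat.add_right_cancel this]; simp
    · rw [← this]; simp
  simp_rw [h]
  rw [Finset.sum_add_distrib, ← Finset.sum_mul, ← Nat.cast_sum,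
    Fin.sum_univ_eq_sum_range (fun i => if gW v (i+1) < gW v i then 1 else 0)]
  change _ + ((dN (gW v) n : ℕ) : ℝ[X]) * _ = _
  rw [← desB_eq, opL]
  simp only [Finset.sum_const, Finset.card_univ, Fintype.card_fin, nsmul_eq_mul, derivative_X_pow]
  rcases desB v with _ | d
  · simp
  · simp only [Nat.add_sub_cancel, map_natCast]
    ring

/-- signed permutations, last letter nonnegative -/
noncomputable def PP (n : ℕ) : ℝ[X] := ∑ v ∈ SP n, if 0 ≤ gW v n then X ^ desB v else 0
/-- signed permutations, last letter negative -/
noncomputable def MM (n : ℕ) : ℝ[X] := ∑ v ∈ SP n, if 0 ≤ gW v n then 0 else X ^ desB v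
/-- unsigned permutations -/
noncomputable def AA (n : ℕ) : ℝ[X] := ∑ v ∈ SP n, if ∀ i, (v i).2 = true then X ^ desB v else 0

lemma gW_ins_cast_last {n : ℕ} (p : Fin n) (s : Bool) (v : Fin n → Fin n × Bool) :
    gW (ins p.castSucc s v) (n + 1) = gW v n := by
  have := p.isLt
  rw [gW_ins, if_neg (by rw [Fin.val_castSucc]; omega), if_neg (by rw [Fin.val_castSucc]; omega),
    Nat.add_sub_cancel]

lemma gW_ins_last_last {n : ℕ} (s : Bool) (v : Fin n → Fin n × Bool) :
    0 ≤ gW (ins (Fin.last n) s v) (n + 1) ↔ s = true := by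
  rw [gW_ins, if_neg (by simp), if_pos (by simp)]
  cases s <;> simp <;> omega

lemma PP_succ (n : ℕ) : PP (n + 1) = 2 * opL n (PP n) + PP n + MM n := by
  have h2 : PP n + MM n = ∑ v ∈ SP n, X ^ desB v := by
    rw [PP, MM, ← Finset.sum_add_distrib]
    refine Finset.sum_congr rfl fun v _ => ?_
    split_ifs <;> simp
  rw [add_assoc, h2, PP, sum_SP, PP, opL_sum, Finset.mul_sum, ← Finset.sum_add_distrib]
  refine Finset.sum_congr rfl fun v _ => ?_
  simp only [Fin.sum_univ_castSucc, gW_ins_cast_last, gW_ins_last_last, des_ins_last, Fintype.sum_bool]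
  by_cases h : 0 ≤ gW v n
  · simp [h, sum_ins]; ring
  · simp [h, opL_zero]

lemma MM_succ (n : ℕ) : MM (n + 1) = 2 * opL n (MM n) + X * (PP n + MM n) := by
  have h2 : PP n + MM n = ∑ v ∈ SP n, X ^ desB v := by
    rw [PP, MM, ← Finset.sum_add_distrib]
    refine Finset.sum_congr rfl fun v _ => ?_
    split_ifs <;> simp
  rw [h2, MM, sum_SP, MM, opL_sum, Finset.mul_sum, Finset.mul_sum, ← Finset.sum_add_distrib]
  refine Finset.sum_congr rfl fun v _ => ?_
  simp only [Fin.sum_univ_castSucc, gW_ins_cast_last, gW_ins_last_last, des_ins_last, Fintype.sum_bool]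
  by_cases h : 0 ≤ gW v n
  · simp [h, opL_zero]; ring
  · simp [h, sum_ins]; ring

lemma ins_all {n : ℕ} (p : Fin (n + 1)) (s : Bool) (v : Fin n → Fin n × Bool) :
    (∀ i, (ins p s v i).2 = true) ↔ s = true ∧ ∀ i, (v i).2 = true := by
  rw [Fin.forall_iff_succAbove p]
  simp only [ins_last_fst, ins_succAbove]

lemma AA_succ (n : ℕ) : AA (n + 1) = opL n (AA n) + AA n := by
  rw [AA, sum_SP, AA, opL_sum, ← Finset.sum_add_distrib]
  refine Finset.sum_congr rfl fun v _ => ?_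
  simp only [Fin.sum_univ_castSucc, ins_all, des_ins_last, Fintype.sum_bool]
  by_cases h : ∀ i, (v i).2 = true
  · simp [h, sum_ins]
  · simp [h, opL_zero]

lemma SP_zero : SP 0 = {Fin.elim0} := by
  ext u
  simp only [SP, mem_filter, mem_univ, true_and, mem_singleton]
  refine ⟨fun _ => Subsingleton.elim _ _, fun _ => ?_⟩
  rw [isSP_iff]
  intro i; exact i.elim0

lemma key (n : ℕ) :
    X * ((1 + X) ^ n * AA n) = X * expand ℝ 2 (PP n) + expand ℝ 2 (MM n) := by
  induction n with
  | zero => simp [AA, PP, MM, SP_zero, gW, desB]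
  | succ n ih =>
    have hd := congrArg derivative ih
    rw [PP_succ, MM_succ, AA_succ]
    have hY : (1 + X) * derivative ((1 + X : ℝ[X]) ^ n) = (n : ℝ[X]) * (1 + X) ^ n := by
      rcases n with _ | n
      · simp
      · simp [derivative_pow]; ring
    simp only [derivative_mul, derivative_add, derivative_X, derivative_expand] at hd
    simp only [opL, map_add, map_mul, map_sub, map_pow, expand_X, map_natCast, map_ofNat]
    simp only [Nat.cast_ofNat] at hd
    simp only [one_mul, Nat.reduceSub, pow_one] at hd
    linear_combination X * (1 - X ^ 2) * hd - X ^ 2 * (1 - X) * AA n * hY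
      + (X + X ^ 2 + 2 * (n : ℝ[X]) * X ^ 2) * ih

lemma Bplus_eq (n : ℕ) : Bplus (n + 1) = PP (n + 1) := by
  rw [Bplus, PP, SP, ← Finset.sum_filter, Finset.filter_filter]
  refine Finset.sum_congr ?_ fun _ _ => rfl
  refine Finset.filter_congr fun u _ => and_congr_right fun _ => ?_
  have : gW u (n + 1) = letterW u (Fin.last n) := by
    simp only [gW, Nat.lt_succ_self, dif_pos]; rfl
  rw [this]
  unfold letterW
  split_ifs <;> omega

lemma desA_eq (n : ℕ) (w : Equiv.Perm (Fin (n + 1))) :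
    desA w = desB (fun i => (w i, true)) := by
  rw [desB_eq, dN, Finset.sum_range_succ', desA, Finset.card_filter, Fin.sum_univ_castSucc]
  congr 1
  · rw [← Fin.sum_univ_eq_sum_range (fun i => if gW (fun i => (w i, true)) (i + 1 + 1) <
      gW (fun i => (w i, true)) (i + 1) then 1 else 0)]
    refine Finset.sum_congr rfl fun i _ => ?_
    have hi := i.isLt
    have h1 : (i : ℕ) + 1 < n + 1 := by omega
    have h2 : (i : ℕ) < n + 1 := by omega
    have h3 : ((i : ℕ) + 1) % (n + 1) = i + 1 := Nat.mod_eq_of_lt h1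
    simp only [gW, h1, h2, dif_pos, letterW, if_true, Fin.val_castSucc, true_and, h3]
    congr 1
    rw [Fin.lt_def]
    simp only [add_lt_add_iff_right, Nat.cast_lt]
    rfl
  · simp [gW, letterW]
    omega

lemma Apoly_eq (n : ℕ) : Apoly (n + 1) = AA (n + 1) := by
  rw [Apoly, if_neg (by omega), AA, SP, ← Finset.sum_filter, Finset.filter_filter]
  refine Finset.sum_bij (fun w _ i => (w i, true)) ?_ ?_ ?_ ?_
  · intro w _
    simp only [mem_filter, mem_univ, true_and, implies_true, and_true]
    exact w.bijective
  · intro w _ w' _ h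
    ext i
    have := congrArg Prod.fst (congrFun h i)
    exact congrArg Fin.val this
  · intro u hu
    simp only [mem_filter, mem_univ, true_and] at hu
    refine ⟨Equiv.ofBijective _ hu.1, mem_univ _, ?_⟩
    funext i
    exact Prod.ext rfl (hu.2 i).symm
  · intro w _
    rw [desA_eq]

end EulAux

/-- For `n ≥ 1`, `B_n^+(x) = E_2((1+x)^n A_n(x))`: the coefficient of `x^k` in `B_n^+`
equals the coefficient of `x^{2k}` in `(1+x)^n A_n(x)`, for every `k`. -/
theorem Bplus_eq_E2 (n : ℕ) (hn : 1 ≤ n) :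
    ∀ k, (Bplus n).coeff k = ((1 + X) ^ n * Apoly n).coeff (2 * k) := by
  intro k
  obtain ⟨m, rfl⟩ : ∃ m, n = m + 1 := ⟨n - 1, by omega⟩
  rw [EulAux.Bplus_eq, EulAux.Apoly_eq]
  have h := congrArg (fun q => coeff q (2 * k + 1)) (EulAux.key (m + 1))
  simp only [coeff_add, coeff_X_mul] at h
  rw [h, mul_comm 2 k, coeff_expand_mul (by norm_num), coeff_expand (by norm_num),
    if_neg (by omega), add_zero]
end

section
/- For every n ≥ 1, the polynomials B_n^+(x) and B_n^-(x) have only real roots. Moreover, for every n ≥ 2 the coefficient sequence of B_n^+(x) is unimodal with a peak at ⌊n/2⌋ and the coefficient sequence of B_n^-(x) is unimodal with a peak at ⌊(n+1)/2⌋. -/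
open Polynomial Finset

/-- extended letter sequence: `0` at index `0`, then the letters -/
def ell {n : ℕ} (u : Fin n → Fin n × Bool) : ℕ → ℤ
  | 0 => 0
  | j + 1 => if h : j < n then letterW u ⟨j, h⟩ else 0

/-- descent indicator -/
def dsc {n : ℕ} (u : Fin n → Fin n × Bool) (i : ℕ) : ℕ :=
  if ell u (i + 1) < ell u i then 1 else 0

lemma desB_eq {n : ℕ} (u : Fin n → Fin n × Bool) :
    desB u = ∑ i ∈ range n, dsc u i := by
  unfold desB
  rw [Finset.card_filter, ← Fin.sum_univ_eq_sum_range]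
  refine Finset.sum_congr rfl fun i _ => ?_
  unfold dsc
  refine if_congr ?_ rfl rfl
  obtain ⟨i, hi⟩ := i
  cases i with
  | zero => simp [ell, hi]
  | succ i =>
    have : i < n := by omega
    simp [ell, hi, this]

/-- insertion of the letter `±(n+1)` in gap `p` -/
def ins {n : ℕ} (u : Fin n → Fin n × Bool) (p : Fin (n + 1)) (s : Bool) :
    Fin (n + 1) → Fin (n + 1) × Bool :=
  Fin.insertNth (α := fun _ => Fin (n + 1) × Bool) p (Fin.last n, s)
    (fun i => ((u i).1.castSucc, (u i).2))

lemma ins_self {n : ℕ} (u : Fin n → Fin n × Bool) (p : Fin (n + 1)) (s : Bool) :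
    ins u p s p = (Fin.last n, s) := by simp [ins]

lemma ins_succAbove {n : ℕ} (u : Fin n → Fin n × Bool) (p : Fin (n + 1)) (s : Bool) (i : Fin n) :
    ins u p s (p.succAbove i) = ((u i).1.castSucc, (u i).2) := by simp [ins]

lemma letterW_succAbove {n : ℕ} (u : Fin n → Fin n × Bool) (p : Fin (n + 1)) (s : Bool)
    (i : Fin n) : letterW (ins u p s) (p.succAbove i) = letterW u i := by
  simp [letterW, ins_succAbove]

/-- inserted letter -/
def nv (n : ℕ) (s : Bool) : ℤ := if s then (n : ℤ) + 1 else -((n : ℤ) + 1)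

lemma ell_ins_lt {n : ℕ} (u : Fin n → Fin n × Bool) (p : Fin (n + 1)) (s : Bool) (j : ℕ)
    (hj : j ≤ p) : ell (ins u p s) j = ell u j := by
  cases j with
  | zero => rfl
  | succ j =>
    have h1 : j < n := by omega
    have h2 : j < n + 1 := by omega
    simp only [ell, h1, h2, dif_pos]
    rw [← letterW_succAbove u p s ⟨j, h1⟩]
    congr 1
    rw [Fin.succAbove_of_castSucc_lt]
    · rfl
    · simp [Fin.lt_def]; omega

lemma ell_ins_eq {n : ℕ} (u : Fin n → Fin n × Bool) (p : Fin (n + 1)) (s : Bool) :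
    ell (ins u p s) (p + 1) = nv n s := by
  have := p.isLt
  simp only [ell, this, dif_pos]
  simp [letterW, ins_self, nv]

lemma ell_ins_gt {n : ℕ} (u : Fin n → Fin n × Bool) (p : Fin (n + 1)) (s : Bool) (j : ℕ)
    (hj : p + 1 ≤ j) (hjn : j ≤ n) : ell (ins u p s) (j + 1) = ell u j := by
  cases j with
  | zero => omega
  | succ j =>
    have h1 : j < n := by omega
    have h2 : j + 1 < n + 1 := by omega
    simp only [ell, h1, h2, dif_pos]
    rw [← letterW_succAbove u p s ⟨j, h1⟩]
    congr 1
    rw [Fin.succAbove_of_le_castSucc]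
    · rfl
    · simp [Fin.le_def]; omega

lemma ell_bound {n : ℕ} (u : Fin n → Fin n × Bool) (j : ℕ) :
    ell u j < n + 1 ∧ -((n : ℤ) + 1) < ell u j := by
  cases j with
  | zero => simp [ell]; omega
  | succ j =>
    simp only [ell]
    split_ifs with h
    · have := (u ⟨j, h⟩).1.isLt
      unfold letterW
      split_ifs <;> omega
    · omega

lemma desB_ins_last {n : ℕ} (u : Fin n → Fin n × Bool) (s : Bool) :
    desB (ins u (Fin.last n) s) = desB u + if s then 0 else 1 := by
  rw [desB_eq, desB_eq, Finset.sum_range_succ]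
  congr 1
  · refine Finset.sum_congr rfl fun i hi => ?_
    rw [Finset.mem_range] at hi
    unfold dsc
    rw [ell_ins_lt _ _ _ _ (by simp; omega), ell_ins_lt _ _ _ _ (by simp; omega)]
  · unfold dsc
    have h := ell_ins_eq u (Fin.last n) s
    simp only [Fin.val_last] at h
    rw [h, ell_ins_lt _ _ _ _ (by simp)]
    have := ell_bound u n
    cases s <;> simp [nv] <;> omega

lemma desB_ins_castSucc {n : ℕ} (u : Fin n → Fin n × Bool) (p : Fin n) (s : Bool) :
    desB (ins u p.castSucc s) + dsc u p = desB u + 1 := by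
  obtain ⟨p, hp⟩ := p
  obtain ⟨m, rfl⟩ : ∃ m, n = p + 1 + m := ⟨n - (p + 1), by omega⟩
  rw [desB_eq, desB_eq]
  have hr : range (p + 1 + m + 1) = range (p + 1 + 1 + m) := by congr 1; ring
  rw [hr, Finset.sum_range_add _ (p + 1 + 1) m, Finset.sum_range_add _ (p + 1) m]
  rw [Finset.sum_range_succ, Finset.sum_range_succ, Finset.sum_range_succ]
  have e1 : ∀ i ∈ range p, dsc (ins u (Fin.castSucc ⟨p, hp⟩) s) i = dsc u i := by
    intro i hi
    rw [Finset.mem_range] at hi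
    unfold dsc
    rw [ell_ins_lt _ _ _ _ (by simp; omega), ell_ins_lt _ _ _ _ (by simp; omega)]
  have e2 : ∀ i ∈ range m, dsc (ins u (Fin.castSucc ⟨p, hp⟩) s) (p + 1 + 1 + i)
      = dsc u (p + 1 + i) := by
    intro i hi
    rw [Finset.mem_range] at hi
    unfold dsc
    rw [show p + 1 + 1 + i = (p + 1 + i) + 1 by ring,
      ell_ins_gt _ _ _ _ (by simp; omega) (by omega),
      ell_ins_gt _ _ _ _ (by simp) (by omega)]
  rw [Finset.sum_congr rfl e1, Finset.sum_congr rfl e2]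
  have e3 : dsc (ins u (Fin.castSucc ⟨p, hp⟩) s) p
      + dsc (ins u (Fin.castSucc ⟨p, hp⟩) s) (p + 1) = 1 := by
    unfold dsc
    have h := ell_ins_eq u (Fin.castSucc ⟨p, hp⟩) s
    simp only [Fin.val_castSucc] at h
    rw [h, ell_ins_lt _ _ _ _ (by simp), ell_ins_gt _ _ _ _ (by simp) (by omega)]
    have h1 := ell_bound u p
    have h2 := ell_bound u (p + 1)
    cases s <;> simp only [nv] <;> split_ifs <;> simp_all <;> omega
  have e4 : ∑ x ∈ range p, dsc u x = (range p).sum (dsc u) := rfl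
  simp only at *
  linarith

lemma ins_isSP {n : ℕ} (u : Fin n → Fin n × Bool) (p : Fin (n + 1)) (s : Bool) (hu : IsSP u) :
    IsSP (ins u p s) := by
  unfold IsSP at *
  rw [← Finite.injective_iff_bijective] at *
  intro a b hab
  simp only at hab
  rcases Fin.eq_self_or_eq_succAbove p a with ha | ⟨a, rfl⟩ <;>
  rcases Fin.eq_self_or_eq_succAbove p b with hb | ⟨b, rfl⟩
  · rw [ha, hb]
  · rw [ha, ins_self, ins_succAbove] at hab
    exact absurd hab.symm (Fin.castSucc_lt_last _).ne
  · rw [hb, ins_self, ins_succAbove] at hab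
    exact absurd hab (Fin.castSucc_lt_last _).ne
  · rw [ins_succAbove, ins_succAbove] at hab
    rw [hu (Fin.castSucc_injective _ hab)]

lemma sum_ins {n : ℕ} (F : (Fin (n + 1) → Fin (n + 1) × Bool) → ℝ[X]) :
    ∑ v ∈ univ.filter (fun v : Fin (n + 1) → Fin (n + 1) × Bool => IsSP v), F v
    = ∑ u ∈ univ.filter (fun u : Fin n → Fin n × Bool => IsSP u),
        ∑ p : Fin (n + 1), ∑ s : Bool, F (ins u p s) := by
  have : ∀ u : Fin n → Fin n × Bool, ∑ p : Fin (n + 1), ∑ s : Bool, F (ins u p s)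
      = ∑ q : Fin (n + 1) × Bool, F (ins u q.1 q.2) := fun u => by
    rw [Fintype.sum_prod_type]
  simp_rw [this]
  rw [← Finset.sum_product']
  symm
  refine Finset.sum_bij (fun x _ => ins x.1 x.2.1 x.2.2) ?_ ?_ ?_ ?_
  · rintro ⟨u, p, s⟩ h
    simp only [mem_product, mem_filter, mem_univ, true_and, and_true] at h ⊢
    exact ins_isSP _ _ _ h
  · rintro ⟨u, p, s⟩ h ⟨u', p', s'⟩ h' heq
    simp only [mem_product, mem_filter, mem_univ, true_and, and_true] at h h' heq
    have hp : p = p' := by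
      have h1 := ins_isSP u' p' s' h'
      apply h1.1
      simp only
      rw [ins_self, ← heq, ins_self]
    subst hp
    have hs : s = s' := by
      have := congrFun heq p
      rw [ins_self, ins_self] at this
      exact (Prod.ext_iff.1 this).2
    subst hs
    have hu : u = u' := by
      funext i
      have := congrFun heq (p.succAbove i)
      rw [ins_succAbove, ins_succAbove, Prod.ext_iff] at this
      exact Prod.ext (Fin.castSucc_injective _ this.1) this.2
    rw [hu]
  · intro v hv
    simp only [mem_filter, mem_univ, true_and] at hv
    obtain ⟨p, hp⟩ := hv.2 (Fin.last n)
    simp only at hp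
    have hne : ∀ i, (v (p.succAbove i)).1 ≠ Fin.last n := by
      intro i h
      exact Fin.succAbove_ne p i (hv.1 (h.trans hp.symm))
    refine ⟨(fun i => ((v (p.succAbove i)).1.castPred (hne i), (v (p.succAbove i)).2),
      p, (v p).2), ?_, ?_⟩
    · simp only [mem_product, mem_filter, mem_univ, true_and, and_true]
      unfold IsSP
      rw [← Finite.injective_iff_bijective]
      intro a b hab
      simp only [Fin.castPred_inj] at hab
      exact Fin.succAbove_right_injective (hv.1 hab)
    · funext j
      rcases Fin.eq_self_or_eq_succAbove p j with rfl | ⟨j, rfl⟩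
      · simp only [ins_self]
        exact Prod.ext hp.symm rfl
      · simp only [ins_succAbove, Fin.castSucc_castPred]
  · intro _ _; rfl

lemma Bplus_eq (n : ℕ) : Bplus n =
    ∑ u ∈ univ.filter (fun u : Fin n → Fin n × Bool => IsSP u),
      if 0 ≤ ell u n then X ^ desB u else 0 := by
  cases n with
  | zero =>
    have : univ.filter (fun u : Fin 0 → Fin 0 × Bool => IsSP u) = {Fin.elim0} := by
      ext u
      have h1 : u = Fin.elim0 := by funext i; exact i.elim0
      have h2 : IsSP u := ⟨fun i => i.elim0, fun i => i.elim0⟩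
      rw [Finset.mem_filter, Finset.mem_singleton]
      exact ⟨fun _ => h1, fun _ => ⟨Finset.mem_univ _, h2⟩⟩
    rw [this]
    simp [Bplus, ell, desB]
  | succ n =>
    rw [← Finset.sum_filter, Finset.filter_filter, Bplus]
    refine Finset.sum_congr (Finset.filter_congr fun u _ => and_congr_right fun _ => ?_)
      fun _ _ => rfl
    simp only [ell, lt_add_iff_pos_right, zero_lt_one, dif_pos]
    change 0 < letterW u (Fin.last n) ↔ 0 ≤ letterW u (Fin.last n)
    unfold letterW
    split_ifs <;> omega

lemma Bminus_eq (n : ℕ) : Bminus n =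
    ∑ u ∈ univ.filter (fun u : Fin n → Fin n × Bool => IsSP u),
      if ell u n < 0 then X ^ desB u else 0 := by
  cases n with
  | zero =>
    simp [Bminus, ell]
  | succ n =>
    rw [← Finset.sum_filter, Finset.filter_filter, Bminus]
    refine Finset.sum_congr (Finset.filter_congr fun u _ => and_congr_right fun _ => ?_)
      fun _ _ => rfl
    simp only [ell, Nat.lt_succ_self, dif_pos]
    rfl

lemma ins_inner_sum {n : ℕ} (u : Fin n → Fin n × Bool) (s : Bool) :
    ∑ p : Fin n, (X : ℝ[X]) ^ desB (ins u p.castSucc s)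
      = (n : ℝ[X]) * X * X ^ desB u + X * (1 - X) * derivative (X ^ desB u) := by
  have h : ∀ p : Fin n, (X : ℝ[X]) ^ desB (ins u p.castSucc s)
      = X ^ (desB u + 1) + (dsc u p : ℝ[X]) * (X ^ desB u - X ^ (desB u + 1)) := by
    intro p
    have := desB_ins_castSucc u p s
    unfold dsc at *
    split_ifs at * with hc
    · have e : desB (ins u p.castSucc s) = desB u := by omega
      rw [e]; simp
    · have e : desB (ins u p.castSucc s) = desB u + 1 := by omega
      rw [e]; simp
  rw [Finset.sum_congr rfl fun p _ => h p, Finset.sum_add_distrib, ← Finset.sum_mul]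
  have h2 : ∑ p : Fin n, ((dsc u p : ℕ) : ℝ[X]) = (desB u : ℝ[X]) := by
    rw [desB_eq, ← Fin.sum_univ_eq_sum_range]; push_cast; rfl
  rw [h2]
  simp only [Finset.sum_const, Finset.card_univ, Fintype.card_fin, nsmul_eq_mul, derivative_X_pow]
  rcases Nat.eq_zero_or_pos (desB u) with h0 | h0
  · rw [h0]; simp
  · obtain ⟨d, hd⟩ : ∃ d, desB u = d + 1 := ⟨desB u - 1, by omega⟩
    rw [hd]
    simp
    ring

lemma Bplus_succ (n : ℕ) : Bplus (n + 1) =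
    2 * ((n : ℝ[X]) * X * Bplus n + X * (1 - X) * derivative (Bplus n)) + (Bplus n + Bminus n) := by
  rw [Bplus_eq (n + 1), sum_ins, Bplus_eq n, Bminus_eq n, derivative_sum, Finset.mul_sum,
    Finset.mul_sum, ← Finset.sum_add_distrib, Finset.mul_sum, ← Finset.sum_add_distrib,
    ← Finset.sum_add_distrib]
  refine Finset.sum_congr rfl fun u _ => ?_
  rw [Finset.sum_comm, Fintype.sum_bool, Fin.sum_univ_castSucc, Fin.sum_univ_castSucc]
  have e1 : ∀ (p : Fin n) s, ell (ins u p.castSucc s) (n + 1) = ell u n := fun p s =>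
    ell_ins_gt _ _ _ _ (by simp) le_rfl
  have e2 : ∀ s, ell (ins u (Fin.last n) s) (n + 1) = nv n s := fun s => by
    have := ell_ins_eq u (Fin.last n) s
    simpa using this
  have n1 : (0 : ℤ) ≤ nv n true := by simp only [nv, if_true]; omega
  have n2 : ¬ (0 : ℤ) ≤ nv n false := by simp [nv]; omega
  simp only [e1, e2, desB_ins_last, if_pos n1, if_neg n2]
  by_cases h : 0 ≤ ell u n
  · simp only [if_pos h, if_neg (not_lt.2 h), ins_inner_sum]
    simp; ring
  · simp only [if_neg h, if_pos (not_le.1 h)]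
    simp

lemma Bminus_succ (n : ℕ) : Bminus (n + 1) =
    2 * ((n : ℝ[X]) * X * Bminus n + X * (1 - X) * derivative (Bminus n))
      + X * (Bplus n + Bminus n) := by
  rw [Bminus_eq (n + 1), sum_ins, Bplus_eq n, Bminus_eq n, derivative_sum, Finset.mul_sum,
    Finset.mul_sum, ← Finset.sum_add_distrib, Finset.mul_sum, ← Finset.sum_add_distrib,
    Finset.mul_sum, ← Finset.sum_add_distrib]
  refine Finset.sum_congr rfl fun u _ => ?_
  rw [Finset.sum_comm, Fintype.sum_bool, Fin.sum_univ_castSucc, Fin.sum_univ_castSucc]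
  have e1 : ∀ (p : Fin n) s, ell (ins u p.castSucc s) (n + 1) = ell u n := fun p s =>
    ell_ins_gt _ _ _ _ (by simp) le_rfl
  have e2 : ∀ s, ell (ins u (Fin.last n) s) (n + 1) = nv n s := fun s => by
    have := ell_ins_eq u (Fin.last n) s
    simpa using this
  have n1 : ¬ nv n true < 0 := by simp only [nv, if_true]; omega
  have n2 : nv n false < 0 := by simp [nv]; omega
  simp only [e1, e2, desB_ins_last, if_pos n2, if_neg n1]
  by_cases h : 0 ≤ ell u n
  · simp only [if_pos h, if_neg (not_lt.2 h)]
    simp; ring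
  · simp only [if_neg h, if_pos (not_le.1 h), ins_inner_sum]
    simp; ring

/-- interleaved coefficients of `Bplus` and `Bminus` -/
noncomputable def gz : ℕ → ℤ → ℝ
  | 0, j => if j = 1 then 1 else 0
  | n + 1, j => j * gz n j + gz n (j - 1) + (2 * n + 3 - j) * gz n (j - 2)

lemma gz_nonpos (n : ℕ) : ∀ j : ℤ, j ≤ 0 → gz n j = 0 := by
  induction n with
  | zero => intro j hj; simp only [gz]; exact if_neg (by omega)
  | succ n ih =>
    intro j hj
    simp [gz, ih j hj, ih (j - 1) (by omega), ih (j - 2) (by omega)]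

lemma gz_one (j : ℤ) : gz 1 j = if j = 1 ∨ j = 2 then 1 else 0 := by
  simp only [gz]
  by_cases h1 : j = 1
  · subst h1; norm_num
  by_cases h2 : j = 2
  · subst h2; norm_num
  by_cases h3 : j = 3
  · subst h3; norm_num
  rw [if_neg h1, if_neg (by omega), if_neg (by omega), if_neg (by omega)]
  simp

lemma gz_symm (n : ℕ) (hn : 1 ≤ n) : ∀ j : ℤ, gz n (2 * n + 1 - j) = gz n j := by
  induction n, hn using Nat.le_induction with
  | base =>
    intro j; rw [gz_one, gz_one]
    refine if_congr ?_ rfl rfl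
    push_cast; omega
  | succ n _ ih =>
    intro j
    simp only [gz]
    have h1 := ih (j - 2)
    have h2 := ih (j - 1)
    have h3 := ih j
    push_cast
    rw [show (2 * ((n : ℤ) + 1) + 1 - j) = 2 * n + 1 - (j - 2) by ring, h1,
      show (2 * (n : ℤ) + 1 - (j - 2) - 1) = 2 * n + 1 - (j - 1) by ring, h2,
      show (2 * (n : ℤ) + 1 - (j - 2) - 2) = 2 * n + 1 - j by ring, h3]
    ring

lemma gz_mono (n : ℕ) : ∀ j : ℤ, j ≤ n + 1 → gz n (j - 1) ≤ gz n j := by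
  induction n with
  | zero =>
    intro j hj
    rw [gz_nonpos 0 (j - 1) (by push_cast at hj; omega)]
    simp only [gz]; split_ifs <;> norm_num
  | succ n ih =>
    intro j hj
    push_cast at hj
    rcases lt_or_ge j 0 with h0 | h0
    · rw [gz_nonpos _ _ (by omega), gz_nonpos _ _ (by omega)]
    rcases eq_or_lt_of_le hj with h | h
    · have := gz_symm (n + 1) (by omega) j
      rw [← this]
      apply le_of_eq
      congr 1
      push_cast; omega
    · have e1 := ih j (by omega)
      have e2 := ih (j - 1) (by omega)
      have e3 := ih (j - 2) (by omega)
      rw [show j - 1 - 1 = j - 2 by ring] at e2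
      rw [show j - 2 - 1 = j - 3 by ring] at e3
      simp only [gz]
      rw [show j - 1 - 1 = j - 2 by ring, show j - 1 - 2 = j - 3 by ring]
      have c1 : (0 : ℝ) ≤ j := by exact_mod_cast h0
      have c2 : (0 : ℝ) ≤ 2 * n + 4 - j := by
        have : (j : ℝ) ≤ n + 1 := by exact_mod_cast (by omega : j ≤ (n : ℤ) + 1)
        have : (0 : ℝ) ≤ n := Nat.cast_nonneg n
        linarith
      have m1 := mul_nonneg c1 (sub_nonneg.2 e1)
      have m3 := mul_nonneg c2 (sub_nonneg.2 e3)
      push_cast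
      nlinarith

lemma gz_mono2 (n : ℕ) (j : ℤ) (hj : j + 2 ≤ n + 1) : gz n j ≤ gz n (j + 2) := by
  have h1 := gz_mono n (j + 1) (by omega)
  have h2 := gz_mono n (j + 2) (by omega)
  rw [show j + 1 - 1 = j by ring] at h1
  rw [show j + 2 - 1 = j + 1 by ring] at h2
  linarith

lemma gz_anti2 (n : ℕ) (hn : 1 ≤ n) (j : ℤ) (hj : (n : ℤ) ≤ j) : gz n (j + 2) ≤ gz n j := by
  have := gz_mono2 n (2 * n + 1 - (j + 2)) (by omega)
  rw [show (2 * (n : ℤ) + 1 - (j + 2) + 2) = 2 * n + 1 - j by ring, gz_symm n hn, gz_symm n hn] at this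
  exact this

lemma rec_coeff_zero (n : ℕ) (P : ℝ[X]) :
    (2 * ((n : ℝ[X]) * X * P + X * (1 - X) * derivative P)).coeff 0 = 0 := by
  simp [coeff_zero_eq_eval_zero]

lemma rec_coeff_succ (n k : ℕ) (P : ℝ[X]) :
    (2 * ((n : ℝ[X]) * X * P + X * (1 - X) * derivative P)).coeff (k + 1)
      = 2 * (k + 1) * P.coeff (k + 1) + 2 * (n - k) * P.coeff k := by
  have : 2 * ((n : ℝ[X]) * X * P + X * (1 - X) * derivative P)
      = X * (C (2 * n : ℝ) * P + C 2 * derivative P - C 2 * (X * derivative P)) := by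
    simp only [map_mul, map_natCast, map_ofNat]; ring
  rw [this, coeff_X_mul, coeff_sub, coeff_add, coeff_C_mul, coeff_C_mul, coeff_C_mul,
    coeff_derivative]
  cases k with
  | zero => simp; ring
  | succ k => rw [coeff_X_mul, coeff_derivative]; push_cast; ring

lemma coeff_gz (n : ℕ) : ∀ k : ℕ, (Bplus n).coeff k = gz n (2 * k + 1) ∧
    (Bminus n).coeff k = gz n (2 * k) := by
  induction n with
  | zero =>
    intro k
    constructor
    · simp only [Bplus, coeff_one, gz]
      refine if_congr ?_ rfl rfl
      omega
    · simp only [Bminus, coeff_zero, gz]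
      rw [if_neg (by omega)]
  | succ n ih =>
    intro k
    rw [Bplus_succ, Bminus_succ, coeff_add, coeff_add, coeff_add]
    cases k with
    | zero =>
      rw [rec_coeff_zero, rec_coeff_zero, (ih 0).1, (ih 0).2]
      simp [gz]
      rw [gz_nonpos n (-1) (by omega), gz_nonpos n (-2) (by omega)]
      simp
    | succ k =>
      rw [rec_coeff_succ, rec_coeff_succ, coeff_X_mul, coeff_add, (ih (k + 1)).1, (ih (k + 1)).2,
        (ih k).1, (ih k).2]
      simp only [gz]
      push_cast
      rw [show 2 * ((k : ℤ) + 1) + 1 - 2 = 2 * k + 1 by ring,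
        show 2 * ((k : ℤ) + 1) + 1 - 1 = 2 * (k + 1) by ring,
        show 2 * ((k : ℤ) + 1) - 2 = 2 * k by ring,
        show 2 * ((k : ℤ) + 1) - 1 = 2 * k + 1 by ring]
      constructor <;> ring

/-! Real-rootedness -/

/-- derivative polynomials -/
noncomputable def Wp : ℕ → ℂ[X]
  | 0 => C (1 / 2) * (X - 1)
  | n + 1 => C (1 / 2) * ((X ^ 2 - 1) * derivative (Wp n))

lemma Wp_deg (n : ℕ) : (Wp n).natDegree = n + 1 := by
  induction n with
  | zero =>
    rw [Wp, natDegree_C_mul (by norm_num)]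
    exact natDegree_X_sub_C (1 : ℂ)
  | succ n ih =>
    rw [Wp, natDegree_C_mul (by norm_num)]
    have h1 : (X ^ 2 - 1 : ℂ[X]).natDegree = 2 := natDegree_X_pow_sub_C (n := 2) (r := (1 : ℂ))
    have h2 : (derivative (Wp n)).natDegree = n := by rw [natDegree_derivative, ih]; rfl
    have h3 : derivative (Wp n) ≠ 0 := by
      intro h
      have := derivative_eq_zero.1 h
      omega
    have h4 : (X ^ 2 - 1 : ℂ[X]) ≠ 0 := by
      intro h; rw [h] at h1; simp at h1
    rw [natDegree_mul h4 h3, h1, h2]; ring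

/-- the segment `[-1,1]` in the complex plane -/
def seg : Set ℂ := {z | z.im = 0 ∧ -1 ≤ z.re ∧ z.re ≤ 1}

lemma seg_convex : Convex ℝ seg := by
  intro x hx y hy a b ha hb hab
  obtain ⟨h1, h2, h3⟩ := hx
  obtain ⟨h4, h5, h6⟩ := hy
  refine ⟨?_, ?_, ?_⟩
  · simp [h1, h4]
  · simp; nlinarith
  · simp; nlinarith

lemma Wp_roots (n : ℕ) : ∀ z : ℂ, (Wp n).eval z = 0 → z ∈ seg := by
  induction n with
  | zero =>
    intro z hz
    simp [Wp, sub_eq_zero] at hz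
    subst hz
    refine ⟨?_, ?_, ?_⟩ <;> norm_num
  | succ n ih =>
    intro z hz
    simp only [Wp, eval_mul, eval_C, eval_sub, eval_pow, eval_X, eval_one] at hz
    rcases mul_eq_zero.1 hz with h | h
    · norm_num at h
    rcases mul_eq_zero.1 h with h | h
    · have : (z - 1) * (z + 1) = 0 := by linear_combination h
      rcases mul_eq_zero.1 this with h | h
      · rw [sub_eq_zero.1 h]; refine ⟨?_, ?_, ?_⟩ <;> norm_num
      · rw [eq_neg_of_add_eq_zero_left h]; refine ⟨?_, ?_, ?_⟩ <;> norm_num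
    · have hd : 0 < (Wp n).degree := by
        rw [← natDegree_pos_iff_degree_pos, Wp_deg]; omega
      have hne : derivative (Wp n) ≠ 0 := by
        intro h
        have := derivative_eq_zero.1 h
        rw [Wp_deg] at this
        omega
      have hm : z ∈ (derivative (Wp n)).rootSet ℂ := by
        rw [mem_rootSet]
        exact ⟨hne, by simpa using h⟩
      have := rootSet_derivative_subset_convexHull_rootSet hd hm
      refine convexHull_min ?_ seg_convex this
      intro w hw
      rw [mem_rootSet] at hw
      exact ih w (by simpa using hw.2)

/-- the evaluation of `t P(t²) + M(t²)` -/
noncomputable def Gt (n : ℕ) (t : ℂ) : ℂ :=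
  t * aeval (t ^ 2) (Bplus n) + aeval (t ^ 2) (Bminus n)

lemma hasDerivAt_aeval_sq (P : ℝ[X]) (t : ℂ) :
    HasDerivAt (fun t : ℂ => aeval (t ^ 2) P) (aeval (t ^ 2) (derivative P) * (2 * t)) t := by
  have h1 := Polynomial.hasDerivAt_aeval P (t ^ 2)
  have h2 : HasDerivAt (fun t : ℂ => t ^ 2) (2 * t) t := by
    simpa using hasDerivAt_pow 2 t
  exact h1.comp t h2

lemma Gt_deriv (n : ℕ) (t : ℂ) : HasDerivAt (Gt n)
    (aeval (t ^ 2) (Bplus n) + t * (aeval (t ^ 2) (derivative (Bplus n)) * (2 * t))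
      + aeval (t ^ 2) (derivative (Bminus n)) * (2 * t)) t := by
  have := ((hasDerivAt_id t).mul (hasDerivAt_aeval_sq (Bplus n) t)).add
    (hasDerivAt_aeval_sq (Bminus n) t)
  refine HasDerivAt.congr_deriv (f := Gt n) this ?_
  simp

lemma Gt_succ (n : ℕ) (t D : ℂ) (hD : HasDerivAt (Gt n) D t) :
    Gt (n + 1) t = (t + (2 * n + 1) * t ^ 2) * Gt n t + t * (1 - t ^ 2) * D := by
  rw [hD.unique (Gt_deriv n t)]
  unfold Gt
  rw [Bplus_succ, Bminus_succ]
  simp only [map_add, map_mul, map_sub, aeval_X, map_one, map_natCast, map_ofNat]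
  ring

lemma Gt_eq (n : ℕ) : ∀ t : ℂ, t ≠ 1 →
    Gt n t = (1 - t) * (1 - t ^ 2) ^ n * (Wp n).eval ((1 + t) / (1 - t)) := by
  induction n with
  | zero =>
    intro t ht
    have : 1 - t ≠ 0 := sub_ne_zero.2 ht.symm
    simp [Gt, Bplus, Bminus, Wp]
    field_simp
    ring
  | succ n ih =>
    intro t ht
    have h1 : 1 - t ≠ 0 := sub_ne_zero.2 ht.symm
    set y := (1 + t) / (1 - t) with hy
    have hdy : HasDerivAt (fun t : ℂ => (1 + t) / (1 - t)) (2 / (1 - t) ^ 2) t := by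
      have := ((hasDerivAt_id t).const_add 1).div ((hasDerivAt_id t).const_sub 1) h1
      refine this.congr_deriv ?_
      simp only [id]
      ring
    have hW : HasDerivAt (fun t : ℂ => (Wp n).eval ((1 + t) / (1 - t)))
        ((derivative (Wp n)).eval y * (2 / (1 - t) ^ 2)) t :=
      HasDerivAt.comp (h₂ := fun z => (Wp n).eval z) t ((Wp n).hasDerivAt y) hdy
    have hp : HasDerivAt (fun t : ℂ => (1 - t ^ 2) ^ n)
        (n * (1 - t ^ 2) ^ (n - 1) * (-(2 * t))) t := by
      have h2 : HasDerivAt (fun t : ℂ => 1 - t ^ 2) (-(2 * t)) t := by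
        simpa using (hasDerivAt_pow 2 t).const_sub 1
      exact h2.pow n
    have hl : HasDerivAt (fun t : ℂ => 1 - t) (-1) t := by
      simpa using (hasDerivAt_id t).const_sub 1
    have hR := (hl.mul hp).mul hW
    have hev : Gt n =ᶠ[nhds t] fun t : ℂ =>
        (1 - t) * (1 - t ^ 2) ^ n * (Wp n).eval ((1 + t) / (1 - t)) := by
      filter_upwards [isOpen_ne.mem_nhds ht] with s hs using ih s hs
    have hG := HasDerivAt.congr_of_eventuallyEq hR hev
    rw [Gt_succ n t _ hG, ih t ht]
    simp only [Wp, eval_mul, eval_C, eval_sub, eval_pow, eval_X, eval_one, ← hy]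
    have hpow : (n : ℂ) * (1 - t ^ 2) ^ (n - 1) * (1 - t ^ 2) = n * (1 - t ^ 2) ^ n := by
      cases n with
      | zero => simp
      | succ n => simp [pow_succ]; ring
    have hy2 : (y ^ 2 - 1) * (1 - t) ^ 2 = 4 * t := by
      rw [hy]; field_simp; ring
    have hy3 : y ^ 2 - 1 = 4 * t / (1 - t) ^ 2 := by
      rw [← hy2]; field_simp
    rw [hy3]
    simp only [Pi.mul_apply]
    generalize eval y (Wp n) = A
    generalize eval y (derivative (Wp n)) = B
    generalize hE : (1 - t ^ 2) ^ n = E at *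
    generalize (n : ℂ) * (1 - t ^ 2) ^ (n - 1) = F at *
    rw [pow_succ (1 - t ^ 2), hE]
    linear_combination (-(2 * t) * t * A * (1 - t)) * hpow

lemma norm_factor (a b : ℝ) (ha : 0 ≤ a) (hb : 0 ≤ b) (t : ℂ) (ht : 0 < t.re) :
    ‖(a : ℂ) - b * t‖ ≤ ‖(a : ℂ) + b * t‖ := by
  rw [← sq_le_sq₀ (norm_nonneg _) (norm_nonneg _), ← Complex.normSq_eq_norm_sq,
    ← Complex.normSq_eq_norm_sq, Complex.normSq_apply, Complex.normSq_apply]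
  simp
  have := mul_nonneg ha (mul_nonneg hb ht.le)
  nlinarith

lemma norm_lt (n : ℕ) (hn : 1 ≤ n) (t : ℂ) (ht : 0 < t.re) (h1 : t ^ 2 ≠ 1) :
    ‖Gt n (-t)‖ < ‖Gt n t‖ := by
  have hm1 : t ≠ 1 := by rintro rfl; simp at h1
  have hm2 : -t ≠ 1 := by
    intro h; apply h1; rw [← neg_sq, h]; simp
  have d1 : 1 - t ≠ 0 := sub_ne_zero.2 hm1.symm
  have d2 : 1 + t ≠ 0 := by
    intro h; apply hm2; linear_combination -h
  have key : ∀ s : ℂ, s ≠ 1 → s ≠ -1 → Gt n s = (1 + s) ^ n * ((Wp n).leadingCoeff *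
      ((Wp n).roots.map fun r => (1 - r) + (1 + r) * s).prod) := by
    intro s hs _
    have e : 1 - s ≠ 0 := sub_ne_zero.2 hs.symm
    rw [Gt_eq n s hs, (IsAlgClosed.splits (Wp n)).eval_eq_prod_roots]
    have hc : Multiset.card (Wp n).roots = n + 1 := by
      rw [← (IsAlgClosed.splits (Wp n)).natDegree_eq_card_roots, Wp_deg]
    have hp : ((Wp n).roots.map fun r => (1 - r) + (1 + r) * s).prod
        = (1 - s) ^ (n + 1) * ((Wp n).roots.map fun r => (1 + s) / (1 - s) - r).prod := by
      have : (fun r : ℂ => (1 - r) + (1 + r) * s)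
          = fun r => (1 - s) * ((1 + s) / (1 - s) - r) := by
        funext r; field_simp; ring
      rw [this, Multiset.prod_map_mul, Multiset.map_const', Multiset.prod_replicate, hc]
    rw [hp, show 1 - s ^ 2 = (1 - s) * (1 + s) by ring, mul_pow]
    ring
  have hm3 : t ≠ -1 := by rintro rfl; simp at hm2
  have hm4 : -t ≠ -1 := by simpa using hm1
  rw [key t hm1 hm3, key (-t) hm2 hm4]
  have hW : Wp n ≠ 0 := by intro h; have := Wp_deg n; rw [h] at this; simp at this
  have hroot : ∀ r ∈ (Wp n).roots, r ∈ seg := fun r hr =>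
    Wp_roots n r ((mem_roots hW).1 hr)
  have hre : ∀ r ∈ (Wp n).roots, ((r.re : ℝ) : ℂ) = r := fun r hr =>
    Complex.ext rfl (hroot r hr).1.symm
  simp only [norm_mul, norm_pow]
  have hlc : 0 < ‖(Wp n).leadingCoeff‖ := norm_pos_iff.2 (leadingCoeff_ne_zero.2 hW)
  have hprodpos : 0 < ‖((Wp n).roots.map fun r => (1 - r) + (1 + r) * t).prod‖ := by
    rw [norm_pos_iff]
    intro h
    rw [Multiset.prod_eq_zero_iff, Multiset.mem_map] at h
    obtain ⟨r, hr, h⟩ := h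
    obtain ⟨g1, g2, g3⟩ := hroot r hr
    have := congrArg Complex.re h
    simp [g1] at this
    rcases eq_or_lt_of_le g3 with h | h
    · rw [h] at this; linarith
    · have := mul_nonneg (by linarith : 0 ≤ 1 + r.re) ht.le
      linarith
  have hprodle : ‖((Wp n).roots.map fun r => (1 - r) + (1 + r) * (-t)).prod‖
      ≤ ‖((Wp n).roots.map fun r => (1 - r) + (1 + r) * t).prod‖ := by
    have hnorm : ∀ f : ℂ → ℂ, ‖((Wp n).roots.map f).prod‖
        = ((Wp n).roots.map fun r => ‖f r‖).prod := by
      intro f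
      have := map_multiset_prod (normHom : ℂ →*₀ ℝ) ((Wp n).roots.map f)
      rw [Multiset.map_map] at this
      exact this
    rw [hnorm, hnorm]
    apply Multiset.prod_map_le_prod_map₀
    · intro r _; exact norm_nonneg _
    · intro r hr
      obtain ⟨g1, g2, g3⟩ := hroot r hr
      have := norm_factor (1 - r.re) (1 + r.re) (by linarith) (by linarith) t ht
      push_cast at this
      rw [hre r hr] at this
      rw [mul_neg, ← sub_eq_add_neg]
      exact this
  have hlt : ‖1 + -t‖ < ‖1 + t‖ := by
    rw [← sq_lt_sq₀ (norm_nonneg _) (norm_nonneg _), ← Complex.normSq_eq_norm_sq,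
      ← Complex.normSq_eq_norm_sq, Complex.normSq_apply, Complex.normSq_apply]
    simp
    nlinarith
  have hltn : ‖1 + -t‖ ^ n < ‖1 + t‖ ^ n := pow_lt_pow_left₀ hlt (norm_nonneg _) (by omega)
  calc _ ≤ ‖1 + -t‖ ^ n * (‖(Wp n).leadingCoeff‖ *
        ‖((Wp n).roots.map fun r => (1 - r) + (1 + r) * t).prod‖) := by gcongr
    _ < _ := by gcongr

lemma im_zero_of_norm_eq (n : ℕ) (hn : 1 ≤ n) (t : ℂ) (h : ‖Gt n (-t)‖ = ‖Gt n t‖) :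
    (t ^ 2).im = 0 := by
  by_cases h1 : t ^ 2 = 1
  · rw [h1]; simp
  rcases lt_trichotomy t.re 0 with h0 | h0 | h0
  · have := norm_lt n hn (-t) (by simpa using h0) (by simpa using h1)
    rw [neg_neg] at this
    linarith
  · simp [pow_two, h0]
  · have := norm_lt n hn t h0 h1
    linarith

/-- For `n ≥ 1`, `B_n^+(x)` and `B_n^-(x)` have only real roots; moreover, for `n ≥ 2`
their coefficient sequences are unimodal with peaks at `⌊n/2⌋` and `⌊(n+1)/2⌋`
respectively. -/
theorem Bplus_Bminus_real_rooted_unimodal (n : ℕ) (hn : 1 ≤ n) :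
    (∀ z : ℂ, Polynomial.aeval z (Bplus n) = 0 → z.im = 0) ∧
    (∀ z : ℂ, Polynomial.aeval z (Bminus n) = 0 → z.im = 0) ∧
    (2 ≤ n →
      (∀ k, k + 1 ≤ n / 2 → (Bplus n).coeff k ≤ (Bplus n).coeff (k + 1)) ∧
      (∀ k, n / 2 ≤ k → k < (Bplus n).natDegree →
          (Bplus n).coeff (k + 1) ≤ (Bplus n).coeff k) ∧
      (∀ k, k + 1 ≤ (n + 1) / 2 → (Bminus n).coeff k ≤ (Bminus n).coeff (k + 1)) ∧
      (∀ k, (n + 1) / 2 ≤ k → k < (Bminus n).natDegree →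
          (Bminus n).coeff (k + 1) ≤ (Bminus n).coeff k)) := by
  refine ⟨?_, ?_, fun _ => ⟨?_, ?_, ?_, ?_⟩⟩
  · intro z hz
    obtain ⟨t, ht⟩ := IsAlgClosed.exists_pow_nat_eq z (n := 2) (by norm_num)
    subst ht
    apply im_zero_of_norm_eq n hn t
    simp [Gt, hz]
  · intro z hz
    obtain ⟨t, ht⟩ := IsAlgClosed.exists_pow_nat_eq z (n := 2) (by norm_num)
    subst ht
    apply im_zero_of_norm_eq n hn t
    simp [Gt, hz]
  · intro k hk
    rw [(coeff_gz n k).1, (coeff_gz n (k + 1)).1]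
    have := gz_mono2 n (2 * k + 1) (by omega)
    convert this using 2
    push_cast; ring
  · intro k hk _
    rw [(coeff_gz n k).1, (coeff_gz n (k + 1)).1]
    have := gz_anti2 n hn (2 * k + 1) (by omega)
    convert this using 2
    push_cast; ring
  · intro k hk
    rw [(coeff_gz n k).2, (coeff_gz n (k + 1)).2]
    have := gz_mono2 n (2 * k) (by omega)
    convert this using 2
    push_cast; ring
  · intro k hk _
    rw [(coeff_gz n k).2, (coeff_gz n (k + 1)).2]
    have := gz_anti2 n hn (2 * k) (by omega)
    convert this using 2
    push_cast; ring
end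

section
/- For every n ≥ 2, f_n^+(x) = (2(n−1)x − 1) · f_{n−1}^+(x) + 2x(1−x) · (d/dx) f_{n−1}^+(x) + 2(n−1)x · f_{n−2}^+(x) + d_{n−1}^B(x). -/
open Polynomial Finset

/-! ### Symmetric polynomials -/

def SymP (N : ℕ) (p : Polynomial ℝ) : Prop :=
  (∀ i j, i + j = N → p.coeff i = p.coeff j) ∧ ∀ i, N < i → p.coeff i = 0

lemma SymP.add {N : ℕ} {p q : Polynomial ℝ} (hp : SymP N p) (hq : SymP N q) :
    SymP N (p + q) := by
  refine ⟨fun i j h => ?_, fun i h => ?_⟩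
  · rw [coeff_add, coeff_add, hp.1 i j h, hq.1 i j h]
  · rw [coeff_add, hp.2 i h, hq.2 i h, add_zero]

lemma SymP.smul {N : ℕ} {p : Polynomial ℝ} (hp : SymP N p) (c : ℝ) :
    SymP N (C c * p) := by
  refine ⟨fun i j h => ?_, fun i h => ?_⟩
  · rw [coeff_C_mul, coeff_C_mul, hp.1 i j h]
  · rw [coeff_C_mul, hp.2 i h, mul_zero]

lemma SymP.X_mul {N : ℕ} {p : Polynomial ℝ} (hp : SymP N p) : SymP (N + 2) (X * p) := by
  refine ⟨fun i j h => ?_, fun i h => ?_⟩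
  · rcases i with _ | i <;> rcases j with _ | j
    · rfl
    · rw [coeff_X_mul_zero, coeff_X_mul, hp.2 j (by omega)]
    · rw [coeff_X_mul_zero, coeff_X_mul, hp.2 i (by omega)]
    · rw [coeff_X_mul, coeff_X_mul, hp.1 i j (by omega)]
  · rcases i with _ | i
    · omega
    · rw [coeff_X_mul, hp.2 i (by omega)]

lemma SymP.one_add_X_mul {N : ℕ} {p : Polynomial ℝ} (hp : SymP N p) :
    SymP (N + 1) ((1 + X) * p) := by
  rw [add_mul, one_mul]
  refine ⟨fun i j h => ?_, fun i h => ?_⟩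
  · rw [coeff_add, coeff_add]
    rcases i with _ | i <;> rcases j with _ | j
    · rfl
    · rw [coeff_X_mul_zero, coeff_X_mul, hp.2 (j+1) (by omega), hp.1 0 j (by omega)]; ring
    · rw [coeff_X_mul_zero, coeff_X_mul, hp.2 (i+1) (by omega), hp.1 i 0 (by omega)]; ring
    · rw [coeff_X_mul, coeff_X_mul, hp.1 i (j+1) (by omega), hp.1 (i+1) j (by omega)]; ring
  · rcases i with _ | i
    · omega
    · rw [coeff_add, coeff_X_mul, hp.2 i (by omega), hp.2 (i+1) (by omega), add_zero]

lemma coeff_L (c : ℝ) (p : Polynomial ℝ) (i : ℕ) :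
    (C c * (X * p) + X * derivative p - X * (X * derivative p)).coeff (i + 1)
      = (i + 1) * p.coeff (i + 1) + (c - i) * p.coeff i := by
  rcases i with _ | i
  · simp [coeff_X_mul, coeff_derivative]; ring
  · simp [coeff_X_mul, coeff_derivative]; ring

lemma SymP.L {N : ℕ} {p : Polynomial ℝ} (hp : SymP N p) :
    SymP (N + 1) (C (N : ℝ) * (X * p) + X * derivative p - X * (X * derivative p)) := by
  refine ⟨fun i j h => ?_, fun i h => ?_⟩
  · rcases i with _ | i <;> rcases j with _ | j
    · rfl
    · rw [coeff_L, hp.2 (j+1) (by omega)]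
      have : j = N := by omega
      subst this
      simp
    · rw [coeff_L, hp.2 (i+1) (by omega)]
      have : i = N := by omega
      subst this
      simp
    · rw [coeff_L, coeff_L, hp.1 i (j+1) (by omega), hp.1 (i+1) j (by omega)]
      have : (N : ℝ) = i + j + 1 := by exact_mod_cast (by omega : N = i + j + 1)
      rw [this]; ring
  · rcases i with _ | i
    · omega
    · rw [coeff_L, hp.2 i (by omega), hp.2 (i+1) (by omega)]; ring

lemma SymP.uniq {N : ℕ} {p q : Polynomial ℝ} (hp : SymP N p) (hq : SymP (N + 1) q)
    (h : p + q = 0) : p = 0 := by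
  have hc : ∀ k, p.coeff k = - q.coeff k := fun k => by
    have := congrArg (fun r => r.coeff k) h
    simp only [coeff_add, coeff_zero] at this
    linarith
  have step : ∀ k, k ≤ N → p.coeff (k + 1) = p.coeff k := fun k hk => by
    rw [hc, hq.1 (k+1) (N - k) (by omega), ← hc, hp.1 (N - k) k (by omega)]
  have all : ∀ k, k ≤ N + 1 → p.coeff k = p.coeff 0 := by
    intro k
    induction k with
    | zero => intro _; rfl
    | succ k ih => intro hk; rw [step k (by omega), ih (by omega)]
  have h0 : p.coeff 0 = 0 := by rw [← all (N+1) le_rfl, hp.2 _ (by omega)]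
  ext k
  rw [coeff_zero]
  by_cases hk : k ≤ N + 1
  · rw [all k hk, h0]
  · exact hp.2 _ (by omega)

/-! ### Weighted signed permutations -/

noncomputable def wt (a b : ℤ) : Polynomial ℝ :=
  if a < b then X else if a = b then (if a < 0 then X else 0) else 1

def vS {n : ℕ} (s : Fin n → Bool) (k : Fin n) : ℤ :=
  if s k then ((k : ℤ) + 1) else -((k : ℤ) + 1)

lemma vS_inj {n : ℕ} (s : Fin n → Bool) (j k : Fin n) : vS s j = vS s k ↔ j = k := by
  constructor
  · intro h
    unfold vS at h
    ext
    split_ifs at h <;> omega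
  · rintro rfl; rfl

noncomputable def GG (n : ℕ) : Polynomial ℝ :=
  ∑ τ : Equiv.Perm (Fin n), ∑ s : Fin n → Bool, ∏ k, wt (vS s k) (vS s (τ k))

lemma wt_id (a b : ℤ) :
    (1 : Polynomial ℝ) = (if a = b ∧ 0 ≤ a then 1 else 0) + (1 - X) * derivative (wt a b) + wt a b := by
  unfold wt
  split_ifs <;> first | omega | (simp) 

/-- the word of a pair -/
def wordOf {n : ℕ} (x : Equiv.Perm (Fin n) × (Fin n → Bool)) : Fin n → Fin n × Bool :=
  fun i => (x.1 i, x.2 (x.1 i))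

lemma letterW_wordOf {n : ℕ} (x : Equiv.Perm (Fin n) × (Fin n → Bool)) (k : Fin n) :
    letterW (wordOf x) k = vS x.2 (x.1 k) := rfl

lemma aVal_wordOf {n : ℕ} (x : Equiv.Perm (Fin n) × (Fin n → Bool)) (k : Fin n) :
    aVal (wordOf x) k = vS x.2 k := by
  have : (∃ j, wordOf x j = (k, true)) ↔ x.2 k = true := by
    constructor
    · rintro ⟨j, hj⟩
      simp only [wordOf, Prod.mk.injEq] at hj
      rw [← hj.1]; exact hj.2
    · intro h
      exact ⟨x.1.symm k, by simp [wordOf, h]⟩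
  unfold aVal vS
  simp only [this]

lemma prod_wt {n : ℕ} (x : Equiv.Perm (Fin n) × (Fin n → Bool)) :
    ∏ k, wt (vS x.2 k) (vS x.2 (x.1 k)) =
      if IsDerB (wordOf x) then X ^ excB (wordOf x) else 0 := by
  split_ifs with h
  · unfold excB
    rw [Finset.card_eq_sum_ones, ← Finset.prod_pow_eq_pow_sum, Finset.prod_filter]
    refine Finset.prod_congr rfl fun k _ => ?_
    have := h k
    rw [aVal_wordOf, letterW_wordOf] at *
    unfold wt
    have hne : vS x.2 k ≠ 0 := by unfold vS; split_ifs <;> omega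
    split_ifs <;> first | omega | simp
  · unfold IsDerB at h
    push Not at h
    obtain ⟨k, hk, he⟩ := h
    rw [aVal_wordOf] at hk he
    rw [letterW_wordOf] at he
    refine Finset.prod_eq_zero (Finset.mem_univ k) ?_
    unfold wt
    rw [he]
    simp [hk.le]

lemma dB_eq_GG (n : ℕ) : dB n = GG n := by
  unfold dB GG
  rw [← Fintype.sum_prod_type']
  rw [Finset.sum_congr rfl (fun x _ => prod_wt x), ← Finset.sum_filter]
  symm
  refine Finset.sum_bij (fun x _ => wordOf x) ?_ ?_ ?_ ?_
  · intro x hx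
    simp only [Finset.mem_filter, Finset.mem_univ, true_and] at hx ⊢
    exact ⟨x.1.bijective, hx⟩
  · rintro ⟨σ, s⟩ _ ⟨τ, t⟩ _ h
    have h1 : σ = τ := by
      ext i
      exact congrArg Fin.val (congrArg Prod.fst (congrFun h i))
    subst h1
    have h2 : s = t := by
      funext i
      have := congrArg Prod.snd (congrFun h (σ.symm i))
      simpa [wordOf] using this
    rw [h2]
  · intro u hu
    simp only [Finset.mem_filter, Finset.mem_univ, true_and] at hu
    obtain ⟨hu1, hu2⟩ := hu
    have hw : wordOf (Equiv.ofBijective _ hu1,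
        fun k => (u ((Equiv.ofBijective _ hu1).symm k)).2) = u := by
      funext i
      unfold wordOf
      refine Prod.ext rfl ?_
      simp only [Equiv.symm_apply_apply]
    refine ⟨_, ?_, hw⟩
    simp only [Finset.mem_filter, Finset.mem_univ, true_and]
    rw [hw]; exact hu2
  · intro x _; rfl

/-! ### Insertion -/

def insEquiv {n : ℕ} (p : Fin (n + 1)) :
    Option (Fin n) × Equiv.Perm (Fin n) ≃ Equiv.Perm (Fin (n + 1)) :=
  Equiv.Perm.decomposeOption.symm.trans (finSuccEquiv' p).symm.permCongr

lemma insEquiv_self {n : ℕ} (p : Fin (n + 1)) (i : Option (Fin n)) (τ : Equiv.Perm (Fin n)) :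
    insEquiv p (i, τ) p = (finSuccEquiv' p).symm i := by
  simp [insEquiv, Equiv.permCongr_apply]

lemma insEquiv_none {n : ℕ} (p : Fin (n + 1)) (τ : Equiv.Perm (Fin n)) (k : Fin n) :
    insEquiv p (none, τ) (p.succAbove k) = p.succAbove (τ k) := by
  simp [insEquiv, Equiv.permCongr_apply]

lemma insEquiv_some_ne {n : ℕ} (p : Fin (n + 1)) (τ : Equiv.Perm (Fin n)) (j k : Fin n)
    (h : k ≠ j) :
    insEquiv p (some (τ j), τ) (p.succAbove k) = p.succAbove (τ k) := by
  have : Equiv.swap none (some (τ j)) (some (τ k)) = some (τ k) :=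
    Equiv.swap_apply_of_ne_of_ne (by simp) (by simpa using h)
  simp [insEquiv, Equiv.permCongr_apply, this]

lemma insEquiv_some_eq {n : ℕ} (p : Fin (n + 1)) (τ : Equiv.Perm (Fin n)) (j : Fin n) :
    insEquiv p (some (τ j), τ) (p.succAbove j) = p := by
  simp [insEquiv, Equiv.permCongr_apply]

lemma sum_signs {n : ℕ} (p : Fin (n + 1)) (F : (Fin (n + 1) → Bool) → Polynomial ℝ) :
    ∑ s, F s = ∑ s : Fin n → Bool,
      (F (p.insertNth (α := fun _ => Bool) true s) + F (p.insertNth (α := fun _ => Bool) false s)) := by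
  rw [← (Fin.insertNthEquiv (fun _ => Bool) p).sum_comp, Fintype.sum_prod_type_right]
  simp [Fin.insertNthEquiv]

lemma vS_last_ins {n : ℕ} (t : Bool) (s : Fin n → Bool) (k : Fin n) :
    vS ((Fin.last n).insertNth (α := fun _ => Bool) t s) ((Fin.last n).succAbove k) = vS s k := by
  simp [vS]

lemma vS_lt {n : ℕ} (s : Fin n → Bool) (k : Fin n) :
    vS s k < n + 1 ∧ -(n + 1 : ℤ) < vS s k := by
  have := k.isLt
  unfold vS
  split_ifs <;> omega

lemma vS_true {n : ℕ} (s : Fin n → Bool) :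
    vS ((Fin.last n).insertNth (α := fun _ => Bool) true s) (Fin.last n) = n + 1 := by
  simp [vS]

lemma vS_false {n : ℕ} (s : Fin n → Bool) :
    vS ((Fin.last n).insertNth (α := fun _ => Bool) false s) (Fin.last n) = -(n + 1 : ℤ) := by
  simp [vS]

/-- order preservation -/
lemma wt_succAbove {n : ℕ} (p : Fin (n + 1)) (t : Bool) (s : Fin n → Bool) (j k : Fin n) :
    wt (vS (p.insertNth (α := fun _ => Bool) t s) (p.succAbove j))
      (vS (p.insertNth (α := fun _ => Bool) t s) (p.succAbove k)) = wt (vS s j) (vS s k) := by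
  have h1 : ((p.succAbove j : Fin (n+1)) : ℕ) < (p.succAbove k : Fin (n+1)) ↔ (j : ℕ) < k := by
    rw [← Fin.lt_def, ← Fin.lt_def]; exact Fin.succAbove_lt_succAbove_iff
  have h2 : ((p.succAbove k : Fin (n+1)) : ℕ) < (p.succAbove j : Fin (n+1)) ↔ (k : ℕ) < j := by
    rw [← Fin.lt_def, ← Fin.lt_def]; exact Fin.succAbove_lt_succAbove_iff
  unfold wt vS
  simp only [Fin.insertNth_apply_succAbove]
  generalize s j = a
  generalize s k = b
  congr 1
  · cases a <;> cases b <;> simp <;> omega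
  · congr 1
    · cases a <;> cases b <;> simp <;> omega
    · congr 1
      cases a <;> simp <;> omega

lemma sum_fixed {n : ℕ} (p : Fin (n + 1)) :
    (∑ τ : Equiv.Perm (Fin (n + 1)), ∑ s : Fin (n + 1) → Bool,
      (if vS s p = vS s (τ p) ∧ 0 ≤ vS s p then 1 else 0) *
        ∏ k ∈ univ.erase p, wt (vS s k) (vS s (τ k))) = GG n := by
  have hp : ∀ F : Fin (n+1) → Polynomial ℝ, ∏ k ∈ univ.erase p, F k = ∏ k, F (p.succAbove k) := by
    intro F
    have : univ.erase p = (univ : Finset (Fin n)).map p.succAboveEmb := by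
      ext x
      simp [Fin.exists_succAbove_eq_iff]
    rw [this, Finset.prod_map]; rfl
  rw [← (insEquiv p).sum_comp, Fintype.sum_prod_type, Fintype.sum_option]
  rw [Finset.sum_eq_zero (s := univ) (f := fun i : Fin n => _), add_zero]
  · unfold GG
    refine Finset.sum_congr rfl fun τ _ => ?_
    rw [sum_signs p]
    refine Finset.sum_congr rfl fun s _ => ?_
    simp only [hp, insEquiv_none, insEquiv_self, wt_succAbove]
    have h1 : (0:ℤ) ≤ vS (p.insertNth (α := fun _ => Bool) true s) p := by simp [vS]; omega
    have h2 : ¬ (0:ℤ) ≤ vS (p.insertNth (α := fun _ => Bool) false s) p := by simp [vS]; omega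
    simp [h1, h2]
  · intro i _
    refine Finset.sum_eq_zero fun τ _ => Finset.sum_eq_zero fun s _ => ?_
    rw [if_neg, zero_mul]
    rintro ⟨h, _⟩
    rw [vS_inj, insEquiv_self] at h
    simp [Fin.ne_succAbove] at h

lemma GG_rec (m : ℕ) : GG (m + 2) = X * GG (m + 1) + 2 * X * ((1 - X) * derivative (GG (m + 1))
      + ((m + 1 : ℕ) : Polynomial ℝ) * GG (m + 1) + ((m + 1 : ℕ) : Polynomial ℝ) * GG m) := by
  have key : ∀ (τ : Equiv.Perm (Fin (m + 1))) (s : Fin (m + 1) → Bool),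
      ∑ j, ∏ k ∈ univ.erase j, wt (vS s k) (vS s (τ k)) =
      ∑ j, (if vS s j = vS s (τ j) ∧ 0 ≤ vS s j then 1 else 0) *
        ∏ k ∈ univ.erase j, wt (vS s k) (vS s (τ k))
      + (1 - X) * derivative (∏ k, wt (vS s k) (vS s (τ k)))
      + ((m + 1 : ℕ) : Polynomial ℝ) * ∏ k, wt (vS s k) (vS s (τ k)) := by
    intro τ s
    have h3 : ((m + 1 : ℕ) : Polynomial ℝ) * ∏ k, wt (vS s k) (vS s (τ k)) =
        ∑ j : Fin (m+1), wt (vS s j) (vS s (τ j)) * ∏ k ∈ univ.erase j, wt (vS s k) (vS s (τ k)) := by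
      rw [Finset.sum_congr rfl (fun j _ => Finset.mul_prod_erase univ
        (fun k => wt (vS s k) (vS s (τ k))) (Finset.mem_univ j))]
      simp
    rw [h3, Polynomial.derivative_prod_finset, Finset.mul_sum, ← Finset.sum_add_distrib,
      ← Finset.sum_add_distrib]
    refine Finset.sum_congr rfl fun j _ => ?_
    have := wt_id (vS s j) (vS s (τ j))
    linear_combination (∏ k ∈ univ.erase j, wt (vS s k) (vS s (τ k))) * this
  have ins : GG (m + 2) = X * GG (m + 1) + 2 * X * ∑ τ : Equiv.Perm (Fin (m + 1)),
      ∑ s : Fin (m + 1) → Bool, ∑ j, ∏ k ∈ univ.erase j, wt (vS s k) (vS s (τ k)) := by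
    conv_lhs => unfold GG
    rw [← (insEquiv (Fin.last (m+1))).sum_comp, Fintype.sum_prod_type, Fintype.sum_option]
    congr 1
    · unfold GG
      rw [Finset.mul_sum]
      refine Finset.sum_congr rfl fun τ _ => ?_
      rw [sum_signs (Fin.last (m+1)), Finset.mul_sum]
      refine Finset.sum_congr rfl fun s _ => ?_
      rw [Fin.prod_univ_succAbove _ (Fin.last (m+1)), Fin.prod_univ_succAbove _ (Fin.last (m+1))]
      simp only [insEquiv_none, insEquiv_self, vS_last_ins, vS_true, vS_false,
        finSuccEquiv'_symm_none]
      have h1 : wt (((m+1:ℕ):ℤ)+1) (((m+1:ℕ):ℤ)+1) = 0 := by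
        unfold wt; rw [if_neg (by omega), if_pos rfl, if_neg (by omega)]
      have h2 : wt (-(((m+1:ℕ):ℤ)+1)) (-(((m+1:ℕ):ℤ)+1)) = X := by
        unfold wt; rw [if_neg (by omega), if_pos rfl, if_pos (by omega)]
      rw [h1, h2]; ring
    · rw [Finset.sum_comm, Finset.mul_sum]
      refine Finset.sum_congr rfl fun τ _ => ?_
      rw [Finset.sum_comm, sum_signs (Fin.last (m+1)), Finset.mul_sum]
      refine Finset.sum_congr rfl fun s _ => ?_
      rw [← Finset.sum_add_distrib, ← Equiv.sum_comp τ, Finset.mul_sum]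
      refine Finset.sum_congr rfl fun j _ => ?_
      have hprod : ∀ t : Bool, ∏ k : Fin (m+1),
          wt (vS ((Fin.last (m+1)).insertNth (α := fun _ => Bool) t s) ((Fin.last (m+1)).succAbove k))
            (vS ((Fin.last (m+1)).insertNth (α := fun _ => Bool) t s)
              (insEquiv (Fin.last (m+1)) (some (τ j), τ) ((Fin.last (m+1)).succAbove k)))
          = wt (vS s j) (vS ((Fin.last (m+1)).insertNth (α := fun _ => Bool) t s) (Fin.last (m+1)))
            * ∏ k ∈ univ.erase j, wt (vS s k) (vS s (τ k)) := by
        intro t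
        rw [← Finset.mul_prod_erase univ _ (Finset.mem_univ j), insEquiv_some_eq, vS_last_ins]
        congr 1
        refine Finset.prod_congr rfl fun k hk => ?_
        rw [insEquiv_some_ne _ _ _ _ (Finset.ne_of_mem_erase hk), vS_last_ins, vS_last_ins]
      rw [Fin.prod_univ_succAbove _ (Fin.last (m+1)), Fin.prod_univ_succAbove _ (Fin.last (m+1)),
        hprod, hprod]
      simp only [insEquiv_self, finSuccEquiv'_symm_some, vS_last_ins, vS_true, vS_false]
      have a1 := vS_lt s j
      have a2 := vS_lt s (τ j)
      have h1 : wt (((m+1:ℕ):ℤ)+1) (vS s (τ j)) = 1 := by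
        unfold wt; rw [if_neg (by omega), if_neg (by omega)]
      have h2 : wt (-(((m+1:ℕ):ℤ)+1)) (vS s (τ j)) = X := by
        unfold wt; rw [if_pos (by omega)]
      have h3 : wt (vS s j) (((m+1:ℕ):ℤ)+1) = X := by
        unfold wt; rw [if_pos (by omega)]
      have h4 : wt (vS s j) (-(((m+1:ℕ):ℤ)+1)) = 1 := by
        unfold wt; rw [if_neg (by omega), if_neg (by omega)]
      rw [h1, h2, h3, h4]; ring
  rw [ins]
  congr 2
  simp only [key, Finset.sum_add_distrib]
  have e1 : ∑ τ : Equiv.Perm (Fin (m + 1)), ∑ s : Fin (m + 1) → Bool,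
      ∑ j, (if vS s j = vS s (τ j) ∧ 0 ≤ vS s j then 1 else 0) *
        ∏ k ∈ univ.erase j, wt (vS s k) (vS s (τ k)) = ((m + 1 : ℕ) : Polynomial ℝ) * GG m := by
    rw [Finset.sum_congr rfl (fun τ _ => Finset.sum_comm), Finset.sum_comm,
      Finset.sum_congr rfl (fun j _ => sum_fixed j)]
    simp
  rw [e1]
  have e2 : derivative (GG (m+1)) = ∑ τ : Equiv.Perm (Fin (m + 1)), ∑ s : Fin (m + 1) → Bool,
      derivative (∏ k, wt (vS s k) (vS s (τ k))) := by
    unfold GG; simp only [derivative_sum]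
  rw [e2]
  have e3 : GG (m+1) = ∑ τ : Equiv.Perm (Fin (m + 1)), ∑ s : Fin (m + 1) → Bool,
      ∏ k, wt (vS s k) (vS s (τ k)) := rfl
  rw [e3]
  simp only [Finset.mul_sum]
  ring

/-- For `n ≥ 2`,
`f_n^+ = (2(n−1)x − 1) f_{n−1}^+ + 2x(1−x) (f_{n−1}^+)' + 2(n−1)x f_{n−2}^+ + d_{n−1}^B`. -/
theorem fplus_recurrence (n : ℕ) (hn : 2 ≤ n) (fp fm : ℕ → Polynomial ℝ)
    (hsum : ∀ m, dB m = fp m + fm m)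
    (hpdeg : ∀ m, (fp m).degree ≤ (m : WithBot ℕ))
    (hpsymm : ∀ m, ∀ k ≤ m, (fp m).coeff k = (fp m).coeff (m - k))
    (hmdeg : ∀ m, (fm m).degree ≤ ((m + 1 : ℕ) : WithBot ℕ))
    (hmsymm : ∀ m, ∀ k ≤ m + 1, (fm m).coeff k = (fm m).coeff (m + 1 - k)) :
    fp n = (2 * ((n : Polynomial ℝ) - 1) * X - 1) * fp (n - 1)
        + 2 * X * (1 - X) * Polynomial.derivative (fp (n - 1))
        + 2 * ((n : Polynomial ℝ) - 1) * X * fp (n - 2)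
        + dB (n - 1) := by
  obtain ⟨m, rfl⟩ : ∃ m, n = m + 2 := ⟨n - 2, by omega⟩
  have hf : ∀ m, SymP m (fp m) := fun m =>
    ⟨fun i j h => by rw [hpsymm m i (by omega)]; congr 1; omega,
     fun i h => Polynomial.coeff_eq_zero_of_degree_lt
      ((hpdeg m).trans_lt (by exact_mod_cast h))⟩
  have hg : ∀ m, SymP (m + 1) (fm m) := fun m =>
    ⟨fun i j h => by rw [hmsymm m i (by omega)]; congr 1; omega,
     fun i h => Polynomial.coeff_eq_zero_of_degree_lt
      ((hmdeg m).trans_lt (by exact_mod_cast h))⟩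
  have hrec := GG_rec m
  simp only [← dB_eq_GG] at hrec
  simp only [hsum] at hrec
  simp only [show m + 2 - 1 = m + 1 from rfl, show m + 2 - 2 = m from rfl, hsum (m + 1)]
  -- the right-hand side is symmetric
  have R : SymP (m + 2) _ := ((((hf (m+1)).L.smul 2).add
    ((hf m).X_mul.smul (2 * ((m + 1 : ℕ) : ℝ)))).add (hg (m+1))).add ((hf (m+2)).smul (-1))
  have S : SymP (m + 2 + 1) _ := ((((hf (m+1)).X_mul.add ((hg (m+1)).L.smul 2)).add
    ((hg (m+1)).one_add_X_mul.smul (-1))).add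
    ((hg m).X_mul.smul (2 * ((m + 1 : ℕ) : ℝ)))).add ((hg (m+2)).smul (-1))
  have := R.uniq S (by
    simp only [derivative_add] at hrec
    simp only [map_mul, map_neg, map_one, map_natCast, map_ofNat]
    push_cast at hrec ⊢
    linear_combination (-1 : Polynomial ℝ) * hrec)
  simp only [map_mul, map_neg, map_one, map_natCast, map_ofNat] at this
  push_cast at this ⊢
  linear_combination (-1 : Polynomial ℝ) * this
end
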